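/- Let T be a triangle with diameter h_T, vertex set 𝒱_T and edge set ℰ_T, and k ≥ 3. There exist positive constants c, C depending only on k and the shape regularity of T such that for every ξ ∈ 𝒱^k(T): c‖ξ‖²_{L₂(T)} ≤ ‖Q_{T,k−4}ξ‖²_{L₂(T)} + Σ_{e∈ℰ_T}[h_T‖Q_{e,k−4}ξ‖²_{L₂(e)} + h_T³‖Q_{e,k−3}(∂ξ/∂n)‖²_{L₂(e)}] + Σ_{p∈𝒱_T}[h_T² ξ(p)² + h_T⁴|∇ξ(p)|²] ≤ C‖ξ‖²_{L₂(T)}. -/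

import Mathlib

open MeasureTheory Real Set
open scoped RealInnerProductSpace
noncomputable section

abbrev E2 := EuclideanSpace ℝ (Fin 2)
def stdb2 (i : Fin 2) : E2 := EuclideanSpace.single i 1
def L2on {n : ℕ} (Ω : Set (EuclideanSpace ℝ (Fin n))) (u : EuclideanSpace ℝ (Fin n) → ℝ) : Prop :=
  MemLp u 2 (volume.restrict Ω)
def IsWeakD {n : ℕ} (Ω : Set (EuclideanSpace ℝ (Fin n)))
    (u v : EuclideanSpace ℝ (Fin n) → ℝ) (d : EuclideanSpace ℝ (Fin n)) : Prop :=
  ∀ φ : EuclideanSpace ℝ (Fin n) → ℝ, ContDiff ℝ (⊤ : ℕ∞) φ → HasCompactSupport φ → tsupport φ ⊆ Ω →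
    ∫ x in Ω, u x * fderiv ℝ φ x d = - ∫ x in Ω, v x * φ x
def tri (p : Fin 3 → E2) : Set E2 := interior (convexHull ℝ (range p))
def evec (p : Fin 3 → E2) (i : Fin 3) : E2 := p (i + 2) - p (i + 1)
def elen (p : Fin 3 → E2) (i : Fin 3) : ℝ := ‖evec p i‖
def tangv (p : Fin 3 → E2) (i : Fin 3) : E2 := (elen p i)⁻¹ • evec p i
def norv (p : Fin 3 → E2) (i : Fin 3) : E2 :=
  EuclideanSpace.single 0 (tangv p i 1) + EuclideanSpace.single 1 (-(tangv p i 0))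
def epar (p : Fin 3 → E2) (i : Fin 3) (t : ℝ) : E2 := p (i + 1) + t • evec p i
def ccw (p : Fin 3 → E2) : Prop :=
  0 < (p 1 - p 0) 0 * (p 2 - p 0) 1 - (p 1 - p 0) 1 * (p 2 - p 0) 0
def tau (i j : Fin 3) : ℝ := if i = j + 1 then 0 else 1

/-- weak derivative on an open interval of `ℝ` -/
def IsWeakD1 (S : Set ℝ) (u v : ℝ → ℝ) : Prop :=
  ∀ φ : ℝ → ℝ, ContDiff ℝ (⊤ : ℕ∞) φ → HasCompactSupport φ → tsupport φ ⊆ S →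
    ∫ t in S, u t * deriv φ t = - ∫ t in S, v t * φ t

def MemHedge : ℕ → (ℝ → ℝ) → Prop
  | 0, u => MemLp u 2 (volume.restrict (Ioo (0:ℝ) 1))
  | (k+1), u => MemLp u 2 (volume.restrict (Ioo (0:ℝ) 1)) ∧
      ∃ v, IsWeakD1 (Ioo (0:ℝ) 1) u v ∧ MemHedge k v

/-- membership of edgewise data in `H²(∂T) × H¹(∂T)` (with pointwise C¹/C⁰ representatives) -/
def MemBdryH2H1 (f g : Fin 3 → ℝ → ℝ) : Prop :=
  ∀ i, MemHedge 2 (f i) ∧ ContDiffOn ℝ 1 (f i) (Icc 0 1) ∧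
    MemHedge 1 (g i) ∧ ContinuousOn (g i) (Icc 0 1)

/-- compatibility conditions (2.2)-(2.4) -/
def Compat (p : Fin 3 → E2) (f g : Fin 3 → ℝ → ℝ) : Prop :=
  (∀ i j k : Fin 3, j ≠ i → k ≠ i → f j (tau i j) = f k (tau i k)) ∧
  ∃ w : Fin 3 → E2, ∀ i j : Fin 3, j ≠ i →
    derivWithin (f j) (Icc 0 1) (tau i j) = elen p j * ⟪w i, tangv p j⟫ ∧
    g j (tau i j) = ⟪w i, norv p j⟫

/-- `H²` membership with explicit weak gradient and Hessian data -/
def MemH2W {n : ℕ} (Ω : Set (EuclideanSpace ℝ (Fin n))) (ξ : EuclideanSpace ℝ (Fin n) → ℝ)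
    (G : Fin n → EuclideanSpace ℝ (Fin n) → ℝ)
    (Hs : Fin n → Fin n → EuclideanSpace ℝ (Fin n) → ℝ) : Prop :=
  L2on Ω ξ ∧ (∀ d, L2on Ω (G d) ∧ IsWeakD Ω ξ (G d) (EuclideanSpace.single d 1)) ∧
  ∀ d d', L2on Ω (Hs d d') ∧ IsWeakD Ω (G d) (Hs d d') (EuclideanSpace.single d' 1)

/-- Gagliardo-type `H^{1/2}` seminorm finiteness for functions on a domain in `ℝⁿ` -/
def GagH12 {n : ℕ} (Ω : Set (EuclideanSpace ℝ (Fin n))) (u : EuclideanSpace ℝ (Fin n) → ℝ) : Prop :=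
  Integrable (fun q : EuclideanSpace ℝ (Fin n) × EuclideanSpace ℝ (Fin n) =>
    (u q.1 - u q.2) ^ 2 / ‖q.1 - q.2‖ ^ (n + 1)) ((volume.restrict Ω).prod (volume.restrict Ω))

/-- membership in `H^{5/2}` of a domain: weak `H²` data whose second derivatives have finite
`H^{1/2}` Gagliardo seminorm. -/
def MemH52 {n : ℕ} (Ω : Set (EuclideanSpace ℝ (Fin n))) (ζ : EuclideanSpace ℝ (Fin n) → ℝ) : Prop :=
  ∃ G Hs, MemH2W Ω ζ G Hs ∧ ∀ d d', GagH12 Ω (Hs d d')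

/-- pointwise trace relation `Tr ζ = (f,g)` on `∂T` for a `C¹` function -/
def TraceEq (p : Fin 3 → E2) (ζ : E2 → ℝ) (f g : Fin 3 → ℝ → ℝ) : Prop :=
  ∀ i : Fin 3, ∀ t ∈ Icc (0:ℝ) 1,
    ζ (epar p i t) = f i t ∧ fderiv ℝ ζ (epar p i t) (norv p i) = g i t

/-- the vector field 𝔤 (2.11) on edge `i`, at parameter `t` -/
def gfield (p : Fin 3 → E2) (f g : Fin 3 → ℝ → ℝ) (i : Fin 3) (t : ℝ) : E2 :=
  ((elen p i)⁻¹ * derivWithin (f i) (Icc 0 1) t) • tangv p i + g i t • norv p i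

/-- the Laplacian of a (smooth) function on `E2` -/
def lap (φ : E2 → ℝ) (x : E2) : ℝ :=
  ∑ i : Fin 2, fderiv ℝ (fun y => fderiv ℝ φ y (stdb2 i)) x (stdb2 i)

/-- `bu` is the edgewise boundary trace of `u` on `∂T` (in the parametrization `epar`),
expressed through the divergence theorem; `Du` is the weak gradient of `u` on `T`. -/
def HasFaceTrace (p : Fin 3 → E2) (u : E2 → ℝ) (Du : Fin 2 → E2 → ℝ)
    (bu : Fin 3 → ℝ → ℝ) : Prop :=
  ∀ φ : E2 → ℝ, ContDiff ℝ (⊤ : ℕ∞) φ → HasCompactSupport φ → ∀ d : Fin 2,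
    ∫ x in tri p, (u x * fderiv ℝ φ x (stdb2 d) + Du d x * φ x)
      = ∑ j : Fin 3, elen p j * ∫ t in Ioo (0:ℝ) 1, bu j t * φ (epar p j t) * norv p j d

/-- `Tr ξ = (f,g)` in the weak (integration by parts) sense: the boundary trace of `ξ`
is `f` and the boundary trace of its gradient is `(∂f/∂t) t + g n` (cf. (2.5), (2.11)). -/
def TraceW (p : Fin 3 → E2) (ξ : E2 → ℝ) (G : Fin 2 → E2 → ℝ)
    (Hs : Fin 2 → Fin 2 → E2 → ℝ) (f g : Fin 3 → ℝ → ℝ) : Prop :=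
  HasFaceTrace p ξ G f ∧
  ∀ d : Fin 2, HasFaceTrace p (G d) (fun d' => Hs d d') (fun j t => gfield p f g j t d)
/-- `u : ℝ → ℝ` is a polynomial of degree at most `m` (`{0}` if `m < 0`) -/
def IsPolyDegLe (m : ℤ) (u : ℝ → ℝ) : Prop :=
  ∃ Q : Polynomial ℝ, (∀ n : ℕ, m < (n : ℤ) → Q.coeff n = 0) ∧ ∀ t, u t = Q.eval t

/-- `u : E2 → ℝ` is a polynomial of total degree at most `m` (`{0}` if `m < 0`) -/
def IsPoly2DegLe (m : ℤ) (u : E2 → ℝ) : Prop :=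
  ∃ Q : MvPolynomial (Fin 2) ℝ,
    (∀ d : Fin 2 →₀ ℕ, m < ((d 0 + d 1 : ℕ) : ℤ) → MvPolynomial.coeff d Q = 0) ∧
    ∀ x : E2, u x = MvPolynomial.eval (fun i => x i) Q

/-- the reference triangle with vertices (0,0), (1,0), (0,1) -/
def refTri : Fin 3 → E2 :=
  ![0, EuclideanSpace.single 0 1, EuclideanSpace.single 1 1]

/-- the distributional bilaplacian of `ξ` on `T` is a polynomial of degree ≤ m -/
def BiharmPoly (p : Fin 3 → E2) (m : ℤ) (ξ : E2 → ℝ) : Prop :=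
  ∃ ρ : E2 → ℝ, IsPoly2DegLe m ρ ∧
    ∀ φ : E2 → ℝ, ContDiff ℝ (⊤ : ℕ∞) φ → HasCompactSupport φ → tsupport φ ⊆ tri p →
      ∫ x in tri p, ξ x * lap (lap φ) x = ∫ x in tri p, ρ x * φ x

/-- `ξ` belongs to the virtual element space `𝒱^k(T)` (defined here for the
reference triangle `p = refTri`), with trace pair `(f,g) ∈ (H²×H¹)_{k,k-1}(∂T)`. -/
def MemVEMT (p : Fin 3 → E2) (k : ℕ) (ξ : E2 → ℝ) (f g : Fin 3 → ℝ → ℝ) : Prop :=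
  (∀ i, IsPolyDegLe (k : ℤ) (f i) ∧ IsPolyDegLe ((k : ℤ) - 1) (g i)) ∧
  Compat p f g ∧
  ∃ G Hs, MemH2W (tri p) ξ G Hs ∧ TraceW p ξ G Hs f g ∧ BiharmPoly p ((k : ℤ) - 4) ξ
/-- the affine map sending the reference triangle onto the triangle with vertices `p`
(orientation preserving when `ccw p`) -/
def affMap (p : Fin 3 → E2) (x : E2) : E2 := p 0 + x 0 • (p 1 - p 0) + x 1 • (p 2 - p 0)

/-- `ξ ∈ 𝒱^k(T)` for a general triangle `T`, defined through the pullback to the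
reference triangle, with trace pair `(f,g) ∈ (H²×H¹)_{k,k-1}(∂T)` exposed. -/
def MemVEMgenT (p : Fin 3 → E2) (k : ℕ) (ξ : E2 → ℝ) (f g : Fin 3 → ℝ → ℝ) : Prop :=
  (∃ fr gr, MemVEMT refTri k (fun x => ξ (affMap p x)) fr gr) ∧
  (∀ i, IsPolyDegLe (k : ℤ) (f i) ∧ IsPolyDegLe ((k : ℤ) - 1) (g i)) ∧
  Compat p f g ∧
  ∃ G Hs, MemH2W (tri p) ξ G Hs ∧ TraceW p ξ G Hs f g

/-- shape regularity: all angles of the triangle are bounded below by `δ` -/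
def MinAngleLB (δ : ℝ) (p : Fin 3 → E2) : Prop :=
  ∀ i : Fin 3, δ ≤ EuclideanGeometry.angle (p (i + 1)) (p i) (p (i + 2))

/-! ### Part A: linear algebra and one-dimensional polynomials -/

lemma vem_bound_of_ker {X F1 F2 : Type*} [AddCommGroup X] [Module ℝ X]
    [NormedAddCommGroup F1] [NormedSpace ℝ F1] [NormedAddCommGroup F2] [NormedSpace ℝ F2]
    (L1 : X →ₗ[ℝ] F1) (L2 : X →ₗ[ℝ] F2) (h : ∀ x, L1 x = 0 → L2 x = 0)
    [FiniteDimensional ℝ (LinearMap.range L1)] :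
    ∃ C : ℝ, 0 < C ∧ ∀ x, ‖L2 x‖ ≤ C * ‖L1 x‖ := by
  let M : LinearMap.range L1 →ₗ[ℝ] F2 :=
    ((LinearMap.ker L1).liftQ L2 (fun x hx => h x hx)) ∘ₗ L1.quotKerEquivRange.symm.toLinearMap
  have hM : ∀ x, M ⟨L1 x, LinearMap.mem_range_self L1 x⟩ = L2 x := by
    intro x
    have : L1.quotKerEquivRange.symm ⟨L1 x, LinearMap.mem_range_self L1 x⟩
        = (LinearMap.ker L1).mkQ x := by
      rw [LinearEquiv.symm_apply_eq]; rfl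
    simp only [M, LinearMap.comp_apply, LinearEquiv.coe_coe, this]
    exact Submodule.liftQ_apply _ _ _
  let Mc := LinearMap.toContinuousLinearMap M
  refine ⟨‖Mc‖ + 1, by positivity, fun x => ?_⟩
  have h1 := Mc.le_opNorm ⟨L1 x, LinearMap.mem_range_self L1 x⟩
  have h2 : Mc ⟨L1 x, LinearMap.mem_range_self L1 x⟩ = L2 x := hM x
  rw [h2] at h1
  refine h1.trans ?_
  have : ‖(⟨L1 x, LinearMap.mem_range_self L1 x⟩ : LinearMap.range L1)‖ = ‖L1 x‖ := rfl
  rw [this]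
  have := norm_nonneg (L1 x)
  nlinarith

lemma vem_range_fd_of_ker {X F1 F2 : Type*} [AddCommGroup X] [Module ℝ X]
    [AddCommGroup F1] [Module ℝ F1] [AddCommGroup F2] [Module ℝ F2]
    (L1 : X →ₗ[ℝ] F1) (L2 : X →ₗ[ℝ] F2) (h : ∀ x, L1 x = 0 → L2 x = 0)
    [FiniteDimensional ℝ F1] : FiniteDimensional ℝ (LinearMap.range L2) := by
  let M : LinearMap.range L1 →ₗ[ℝ] F2 :=
    ((LinearMap.ker L1).liftQ L2 (fun x hx => h x hx)) ∘ₗ L1.quotKerEquivRange.symm.toLinearMap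
  have hle : LinearMap.range L2 ≤ LinearMap.range M := by
    rintro _ ⟨x, rfl⟩
    refine ⟨⟨L1 x, LinearMap.mem_range_self L1 x⟩, ?_⟩
    have : L1.quotKerEquivRange.symm ⟨L1 x, LinearMap.mem_range_self L1 x⟩
        = (LinearMap.ker L1).mkQ x := by
      rw [LinearEquiv.symm_apply_eq]; rfl
    simp only [M, LinearMap.comp_apply, LinearEquiv.coe_coe, this]
    exact Submodule.liftQ_apply _ _ _
  exact Submodule.finiteDimensional_of_le hle

lemma vem_sq_le_norm_sq {ι : Type*} [Fintype ι] (v : ι → ℝ) (i : ι) : (v i) ^ 2 ≤ ‖v‖ ^ 2 := by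
  have := norm_le_pi_norm v i
  rw [← sq_abs (v i)]
  exact pow_le_pow_left₀ (abs_nonneg _) this 2

lemma vem_norm_sq_le {ι : Type*} [Fintype ι] (v : ι → ℝ) : ‖v‖ ^ 2 ≤ ∑ i, (v i) ^ 2 := by
  have : ‖v‖ ≤ √(∑ i, (v i) ^ 2) := by
    rw [pi_norm_le_iff_of_nonneg (by positivity)]
    intro i
    apply Real.le_sqrt_of_sq_le
    rw [Real.norm_eq_abs, sq_abs]
    exact Finset.single_le_sum (f := fun i => (v i) ^ 2) (fun _ _ => sq_nonneg _) (Finset.mem_univ i)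
  calc ‖v‖ ^ 2 ≤ (√(∑ i, (v i) ^ 2)) ^ 2 := pow_le_pow_left₀ (norm_nonneg _) this 2
    _ = _ := Real.sq_sqrt (Finset.sum_nonneg fun _ _ => sq_nonneg _)

lemma vem_bound_sq {X ι κ : Type*} [AddCommGroup X] [Module ℝ X] [Fintype ι] [Fintype κ]
    (L1 : X →ₗ[ℝ] (ι → ℝ)) (L2 : X →ₗ[ℝ] (κ → ℝ)) (h : ∀ x, L1 x = 0 → L2 x = 0) :
    ∃ C : ℝ, 0 < C ∧ ∀ x, ∑ i, (L2 x i) ^ 2 ≤ C * ∑ i, (L1 x i) ^ 2 := by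
  obtain ⟨C, hC, hb⟩ := vem_bound_of_ker L1 L2 h
  refine ⟨(Fintype.card κ + 1) * C ^ 2, by positivity, fun x => ?_⟩
  calc ∑ i, (L2 x i) ^ 2 ≤ ∑ i : κ, (C * ‖L1 x‖) ^ 2 := by
        refine Finset.sum_le_sum fun i _ => (vem_sq_le_norm_sq _ i).trans ?_
        exact pow_le_pow_left₀ (norm_nonneg _) (hb x) 2
    _ = Fintype.card κ * C ^ 2 * ‖L1 x‖ ^ 2 := by simp; ring
    _ ≤ (Fintype.card κ + 1) * C ^ 2 * ‖L1 x‖ ^ 2 := by gcongr; linarith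
    _ ≤ _ := by gcongr; exact vem_norm_sq_le _

lemma vem_cs {α : Type*} [MeasurableSpace α] {μ : Measure α} {u v : α → ℝ}
    (hu : MemLp u 2 μ) (hv : MemLp v 2 μ) :
    (∫ x, u x * v x ∂μ) ^ 2 ≤ (∫ x, (u x) ^ 2 ∂μ) * ∫ x, (v x) ^ 2 ∂μ := by
  have h1 : Integrable (fun x => (u x) ^ 2) μ := hu.integrable_sq
  have h2 : Integrable (fun x => (v x) ^ 2) μ := hv.integrable_sq
  have h3 : Integrable (fun x => u x * v x) μ := hu.integrable_mul hv
  have key : ∀ t : ℝ, 0 ≤ (∫ x, (v x) ^ 2 ∂μ) * (t * t) + (2 * ∫ x, u x * v x ∂μ) * t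
      + ∫ x, (u x) ^ 2 ∂μ := by
    intro t
    have : 0 ≤ ∫ x, (u x + t * v x) ^ 2 ∂μ := integral_nonneg fun x => sq_nonneg _
    have e : ∫ x, (u x + t * v x) ^ 2 ∂μ
        = ∫ x, ((t * t) * (v x) ^ 2 + (2 * t) * (u x * v x)) + (u x) ^ 2 ∂μ := by
      congr 1; ext x; ring
    have h4 : Integrable (fun x => (t * t) * (v x) ^ 2 + (2 * t) * (u x * v x)) μ :=
      (h2.const_mul _).add (h3.const_mul _)
    rw [e, integral_add h4 h1,
      integral_add (h2.const_mul _) (h3.const_mul _), integral_const_mul, integral_const_mul] at this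
    linarith
  have := discrim_le_zero key
  unfold discrim at this
  nlinarith

open Polynomial in
def nP (k : ℕ) (P : ℝ[X]) : ℝ := ∑ i : Fin (k + 1), (P.coeff i) ^ 2

open Polynomial in
lemma nP_nonneg (k : ℕ) (P : ℝ[X]) : 0 ≤ nP k P := Finset.sum_nonneg fun _ _ => sq_nonneg _

lemma vem_cont_memLp (u : ℝ → ℝ) (hu : Continuous u) :
    MemLp u 2 (volume.restrict (Ioo (0:ℝ) 1)) := by
  rw [memLp_two_iff_integrable_sq hu.aestronglyMeasurable]
  exact ((hu.pow 2).integrableOn_Icc (a := 0) (b := 1)).mono_set Ioo_subset_Icc_self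

lemma vem_cont_int (u : ℝ → ℝ) (hu : Continuous u) :
    Integrable u (volume.restrict (Ioo (0:ℝ) 1)) :=
  (hu.integrableOn_Icc (a := 0) (b := 1)).mono_set Ioo_subset_Icc_self

open Polynomial in
lemma vem_poly_zero (W R : ℝ[X]) (hW : ∀ t ∈ Ioo (0:ℝ) 1, 0 < W.eval t)
    (h : ∫ t in Ioo (0:ℝ) 1, W.eval t * (R.eval t * R.eval t) = 0) : R = 0 := by
  have hc : Continuous fun t => W.eval t * (R.eval t * R.eval t) := by fun_prop
  have h0 : 0 ≤ᵐ[volume.restrict (Ioo (0:ℝ) 1)] fun t => W.eval t * (R.eval t * R.eval t) := by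
    filter_upwards [ae_restrict_mem measurableSet_Ioo] with t ht
    exact mul_nonneg (hW t ht).le (mul_self_nonneg _)
  rw [integral_eq_zero_iff_of_nonneg_ae h0 (vem_cont_int _ hc)] at h
  have := Measure.eqOn_open_of_ae_eq h isOpen_Ioo hc.continuousOn continuousOn_const
  refine Polynomial.eq_zero_of_infinite_isRoot R
    ((Ioo_infinite (zero_lt_one' ℝ)).mono fun t ht => ?_)
  have h1 := this ht
  have h2 := hW t ht
  have h3 : R.eval t * R.eval t = 0 := by
    rcases mul_eq_zero.1 h1 with h | h
    · linarith
    · exact h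
  exact mul_self_eq_zero.1 h3

open Polynomial in
/-- one-dimensional unisolvence -/
lemma vem_unisolv (W P : ℝ[X]) (n : ℕ) (hW : ∀ t ∈ Ioo (0:ℝ) 1, 0 < W.eval t) (hW0 : W ≠ 0)
    (hd : W ∣ P) (hdeg : P.natDegree < W.natDegree + n)
    (hmom : ∀ a < n, ∫ t in Ioo (0:ℝ) 1, P.eval t * t ^ a = 0) : P = 0 := by
  obtain ⟨R, rfl⟩ := hd
  by_cases hR : R = 0
  · simp [hR]
  exfalso; apply hR
  apply vem_poly_zero W R hW
  rw [natDegree_mul hW0 hR] at hdeg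
  have : ∀ t, W.eval t * (R.eval t * R.eval t)
      = ∑ a ∈ Finset.range (R.natDegree + 1), R.coeff a * ((W * R).eval t * t ^ a) := by
    intro t
    have e := Polynomial.eval_eq_sum_range (p := R) t
    rw [eval_mul, ← mul_assoc]
    nth_rewrite 2 [e]
    rw [Finset.mul_sum]
    exact Finset.sum_congr rfl fun a _ => by ring
  simp_rw [this]
  rw [integral_finsetSum]
  · refine Finset.sum_eq_zero fun a ha => ?_
    rw [integral_const_mul, hmom a (by simp at ha; omega), mul_zero]
  · intro a _
    exact (vem_cont_int _ (by fun_prop))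

open Polynomial in
lemma vem_isPoly_mono (m : ℤ) (a : ℕ) (h : (a : ℤ) ≤ m) : IsPolyDegLe m (fun t => t ^ a) := by
  refine ⟨X ^ a, fun n hn => ?_, by simp⟩
  rw [coeff_X_pow, if_neg]; omega

lemma vem_isPoly_cont {m : ℤ} {u : ℝ → ℝ} (h : IsPolyDegLe m u) : Continuous u := by
  obtain ⟨Q, -, hQ⟩ := h
  have : u = fun t => Q.eval t := funext hQ
  rw [this]; fun_prop

lemma vem_mom_sq (u q : ℝ → ℝ) (m : ℤ) (a : ℕ) (ha : (a : ℤ) ≤ m) (hu : Continuous u)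
    (hq : IsPolyDegLe m q)
    (h : ∀ r : ℝ → ℝ, IsPolyDegLe m r → ∫ t in Ioo (0:ℝ) 1, (u t - q t) * r t = 0) :
    (∫ t in Ioo (0:ℝ) 1, u t * t ^ a) ^ 2 ≤ ∫ t in Ioo (0:ℝ) 1, (q t) ^ 2 := by
  have hqc := vem_isPoly_cont hq
  have h1 := h _ (vem_isPoly_mono m a ha)
  have h2 : ∫ t in Ioo (0:ℝ) 1, u t * t ^ a = ∫ t in Ioo (0:ℝ) 1, q t * t ^ a := by
    rw [← sub_eq_zero, ← integral_sub (vem_cont_int _ (by fun_prop)) (vem_cont_int _ (by fun_prop))]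
    refine Eq.trans ?_ h1; congr 1; ext t; ring
  rw [h2]
  refine (vem_cs (vem_cont_memLp _ hqc) (vem_cont_memLp (fun t => t ^ a) (by fun_prop))).trans ?_
  have h3 : ∫ t in Ioo (0:ℝ) 1, (t ^ a) ^ 2 ≤ 1 := by
    have : ∫ t in Ioo (0:ℝ) 1, (t ^ a) ^ 2 ≤ ∫ t in Ioo (0:ℝ) 1, (1:ℝ) := by
      refine setIntegral_mono_on (vem_cont_int _ (by fun_prop)) (vem_cont_int _ (by fun_prop))
        measurableSet_Ioo fun t ht => ?_
      exact pow_le_one₀ (by have := ht.1; positivity) (pow_le_one₀ ht.1.le ht.2.le)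
    simpa using this
  have h4 : 0 ≤ ∫ t in Ioo (0:ℝ) 1, (q t) ^ 2 := integral_nonneg fun t => sq_nonneg _
  nlinarith

lemma vem_proj_le (u q : ℝ → ℝ) (m : ℤ) (hu : Continuous u)
    (hq : IsPolyDegLe m q)
    (h : ∀ r : ℝ → ℝ, IsPolyDegLe m r → ∫ t in Ioo (0:ℝ) 1, (u t - q t) * r t = 0) :
    ∫ t in Ioo (0:ℝ) 1, (q t) ^ 2 ≤ ∫ t in Ioo (0:ℝ) 1, (u t) ^ 2 := by
  have hqc := vem_isPoly_cont hq
  have h1 := h _ hq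
  have h2 : 0 ≤ ∫ t in Ioo (0:ℝ) 1, (u t - q t) ^ 2 := integral_nonneg fun t => sq_nonneg _
  have h3 : ∫ t in Ioo (0:ℝ) 1, (u t) ^ 2 = ∫ t in Ioo (0:ℝ) 1, (((u t - q t) ^ 2
      + 2 * ((u t - q t) * q t)) + (q t) ^ 2) := by congr 1; ext t; ring
  rw [h3, integral_add (vem_cont_int _ (by fun_prop)) (vem_cont_int _ (by fun_prop)),
    integral_add (vem_cont_int _ (by fun_prop)) (vem_cont_int _ (by fun_prop)),
    integral_const_mul, h1]
  linarith

open Polynomial in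
/-- moments as a linear map -/
def momL (n : ℕ) : ℝ[X] →ₗ[ℝ] (Fin n → ℝ) where
  toFun P := fun a => ∫ t in Ioo (0:ℝ) 1, P.eval t * t ^ (a : ℕ)
  map_add' P Q := by
    ext a
    simp only [eval_add, add_mul, Pi.add_apply]
    exact integral_add (vem_cont_int _ (by fun_prop)) (vem_cont_int _ (by fun_prop))
  map_smul' c P := by
    ext a
    simp only [eval_smul, smul_eq_mul, mul_assoc, Pi.smul_apply, RingHom.id_apply]
    exact integral_const_mul _ _

open Polynomial in
def coefL (k : ℕ) : ℝ[X] →ₗ[ℝ] (Fin (k + 1) → ℝ) where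
  toFun P := fun a => P.coeff a
  map_add' P Q := by ext a; simp
  map_smul' c P := by ext a; simp

open Polynomial in
def endF : ℝ[X] →ₗ[ℝ] (Fin 4 → ℝ) where
  toFun P := ![P.eval 0, P.eval 1, P.derivative.eval 0, P.derivative.eval 1]
  map_add' P Q := by ext a; fin_cases a <;> simp
  map_smul' c P := by ext a; fin_cases a <;> simp

open Polynomial in
def endG : ℝ[X] →ₗ[ℝ] (Fin 2 → ℝ) where
  toFun P := ![P.eval 0, P.eval 1]
  map_add' P Q := by ext a; fin_cases a <;> simp
  map_smul' c P := by ext a; fin_cases a <;> simp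

def sumL {X ι κ : Type*} [AddCommGroup X] [Module ℝ X] (L1 : X →ₗ[ℝ] (ι → ℝ))
    (L2 : X →ₗ[ℝ] (κ → ℝ)) : X →ₗ[ℝ] (ι ⊕ κ → ℝ) where
  toFun x := Sum.elim (L1 x) (L2 x)
  map_add' x y := by ext (a | a) <;> simp
  map_smul' c x := by ext (a | a) <;> simp

open Polynomial in
lemma vem_natDegree_le {k : ℕ} {P : ℝ[X]} (h : P ∈ degreeLE ℝ k) : P.natDegree ≤ k :=
  natDegree_le_of_degree_le (mem_degreeLE.1 h)

open Polynomial in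
lemma vem_polyF (k : ℕ) (hk : 3 ≤ k) : ∃ C : ℝ, 0 < C ∧ ∀ P : ℝ[X], P ∈ degreeLE ℝ k →
    ∀ q : ℝ → ℝ, IsPolyDegLe ((k : ℤ) - 4) q →
    (∀ r : ℝ → ℝ, IsPolyDegLe ((k : ℤ) - 4) r → ∫ t in Ioo (0:ℝ) 1, (P.eval t - q t) * r t = 0) →
    nP k P ≤ C * ((∫ t in Ioo (0:ℝ) 1, (q t) ^ 2) + ((P.eval 0) ^ 2 + (P.eval 1) ^ 2 +
      (P.derivative.eval 0) ^ 2 + (P.derivative.eval 1) ^ 2)) := by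
  let S := (degreeLE ℝ (k : WithBot ℕ)).subtype
  obtain ⟨C, hC, h⟩ := vem_bound_sq ((sumL (momL (k - 3)) endF) ∘ₗ S) ((coefL k) ∘ₗ S) (by
    rintro ⟨P, hP⟩ h0
    suffices P = 0 by subst this; ext; simp [coefL, S]
    have hm : ∀ a : Fin (k - 3), momL (k - 3) P a = 0 := fun a => congrFun h0 (Sum.inl a)
    have he : ∀ a : Fin 4, endF P a = 0 := fun a => congrFun h0 (Sum.inr a)
    have e0 : P.eval 0 = 0 := he 0
    have e1 : P.eval 1 = 0 := he 1
    have e2 : P.derivative.eval 0 = 0 := he 2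
    have e3 : P.derivative.eval 1 = 0 := he 3
    by_contra hne
    have d0 : (X - C (0:ℝ)) ^ 2 ∣ P :=
      (le_rootMultiplicity_iff hne).1 ((one_lt_rootMultiplicity_iff_isRoot hne).2 ⟨e0, e2⟩)
    have d1 : (X - C (1:ℝ)) ^ 2 ∣ P :=
      (le_rootMultiplicity_iff hne).1 ((one_lt_rootMultiplicity_iff_isRoot hne).2 ⟨e1, e3⟩)
    have hcop : IsCoprime ((X - C (0:ℝ)) ^ 2) ((X - C (1:ℝ)) ^ 2) :=
      (isCoprime_X_sub_C_of_isUnit_sub (by norm_num)).pow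
    have hmon : ((X - C (0:ℝ)) ^ 2 * (X - C (1:ℝ)) ^ 2).Monic :=
      ((monic_X_sub_C _).pow 2).mul ((monic_X_sub_C _).pow 2)
    refine hne (vem_unisolv ((X - C (0:ℝ)) ^ 2 * (X - C (1:ℝ)) ^ 2) P (k - 3) ?_ hmon.ne_zero
      (hcop.mul_dvd d0 d1) ?_ ?_)
    · intro t ht
      have h1 := ht.1
      have h2 : t - 1 ≠ 0 := by have := ht.2; linarith
      simp; positivity
    · rw [natDegree_mul (pow_ne_zero _ (X_sub_C_ne_zero _)) (pow_ne_zero _ (X_sub_C_ne_zero _)),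
        natDegree_pow, natDegree_pow, natDegree_X_sub_C, natDegree_X_sub_C]
      have := vem_natDegree_le hP
      omega
    · intro a ha
      exact hm ⟨a, ha⟩)
  refine ⟨C * (k + 1), by positivity, fun P hP q hq hr => ?_⟩
  have h1 := h ⟨P, hP⟩
  have h2 : ∑ i, (((coefL k) ∘ₗ S) ⟨P, hP⟩ i) ^ 2 = nP k P := rfl
  rw [h2, Fintype.sum_sum_type] at h1
  refine h1.trans ?_
  rw [mul_assoc]
  gcongr
  have h3 : ∀ a : Fin (k - 3), (((sumL (momL (k - 3)) endF) ∘ₗ S) ⟨P, hP⟩ (Sum.inl a)) ^ 2 ≤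
      ∫ t in Ioo (0:ℝ) 1, (q t) ^ 2 := fun a =>
    vem_mom_sq (fun t => P.eval t) q _ a (by omega) (by fun_prop) hq hr
  have h4 : ∑ a : Fin 4, (((sumL (momL (k - 3)) endF) ∘ₗ S) ⟨P, hP⟩ (Sum.inr a)) ^ 2 =
    ((P.eval 0) ^ 2 + (P.eval 1) ^ 2 +
      (P.derivative.eval 0) ^ 2 + (P.derivative.eval 1) ^ 2) := by
    simp [sumL, endF, Fin.sum_univ_four, S]
  rw [h4]
  have h5 := Finset.sum_le_sum (s := Finset.univ) fun a _ => h3 a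
  rw [Finset.sum_const, Finset.card_univ, Fintype.card_fin, nsmul_eq_mul] at h5
  have h6 : ((k - 3 : ℕ) : ℝ) ≤ k := by exact_mod_cast Nat.sub_le k 3
  have h7 : 0 ≤ ∫ t in Ioo (0:ℝ) 1, (q t) ^ 2 := integral_nonneg fun t => sq_nonneg _
  have h8 : 0 ≤ ((P.eval 0) ^ 2 + (P.eval 1) ^ 2 +
      (P.derivative.eval 0) ^ 2 + (P.derivative.eval 1) ^ 2) := by positivity
  have h9 : (0:ℝ) ≤ k := by positivity
  nlinarith [mul_nonneg h9 h8, mul_le_mul_of_nonneg_right h6 h7]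

open Polynomial in
lemma vem_polyG (k : ℕ) (hk : 3 ≤ k) : ∃ C : ℝ, 0 < C ∧ ∀ P : ℝ[X], P ∈ degreeLE ℝ ((k - 1 : ℕ) : WithBot ℕ) →
    ∀ q : ℝ → ℝ, IsPolyDegLe ((k : ℤ) - 3) q →
    (∀ r : ℝ → ℝ, IsPolyDegLe ((k : ℤ) - 3) r → ∫ t in Ioo (0:ℝ) 1, (P.eval t - q t) * r t = 0) →
    nP k P ≤ C * ((∫ t in Ioo (0:ℝ) 1, (q t) ^ 2) + ((P.eval 0) ^ 2 + (P.eval 1) ^ 2)) := by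
  let S := (degreeLE ℝ ((k - 1 : ℕ) : WithBot ℕ)).subtype
  obtain ⟨C, hC, h⟩ := vem_bound_sq ((sumL (momL (k - 2)) endG) ∘ₗ S) ((coefL k) ∘ₗ S) (by
    rintro ⟨P, hP⟩ h0
    suffices P = 0 by subst this; ext; simp [coefL, S]
    have hm : ∀ a : Fin (k - 2), momL (k - 2) P a = 0 := fun a => congrFun h0 (Sum.inl a)
    have he : ∀ a : Fin 2, endG P a = 0 := fun a => congrFun h0 (Sum.inr a)
    have e0 : P.eval 0 = 0 := he 0
    have e1 : P.eval 1 = 0 := he 1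
    by_contra hne
    have d0 : (X - C (0:ℝ)) ∣ P := dvd_iff_isRoot.2 e0
    have d1 : (C (1:ℝ) - X) ∣ P := by
      rw [← neg_sub, neg_dvd]; exact dvd_iff_isRoot.2 e1
    have hcop : IsCoprime ((X - C (0:ℝ))) ((C (1:ℝ) - X)) := by
      rw [← neg_sub X, IsCoprime.neg_right_iff]
      exact (isCoprime_X_sub_C_of_isUnit_sub (by norm_num))
    have hn1 : (C (1:ℝ) - X) ≠ 0 := by
      rw [← neg_sub, neg_ne_zero]; exact X_sub_C_ne_zero _
    have hnd : (C (1:ℝ) - X).natDegree = 1 := by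
      rw [← neg_sub, natDegree_neg, natDegree_X_sub_C]
    refine hne (vem_unisolv ((X - C (0:ℝ)) * (C (1:ℝ) - X)) P (k - 2) ?_
      (mul_ne_zero (X_sub_C_ne_zero _) hn1)
      (hcop.mul_dvd d0 d1) ?_ ?_)
    · intro t ht
      have h1 := ht.1
      have h2 : 0 < 1 - t := by have := ht.2; linarith
      simp only [eval_mul, eval_sub, eval_X, eval_C, sub_zero]; positivity
    · rw [natDegree_mul (X_sub_C_ne_zero _) hn1, natDegree_X_sub_C, hnd]
      have := vem_natDegree_le hP
      omega
    · intro a ha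
      exact hm ⟨a, ha⟩)
  refine ⟨C * (k + 1), by positivity, fun P hP q hq hr => ?_⟩
  have h1 := h ⟨P, hP⟩
  have h2 : ∑ i, (((coefL k) ∘ₗ S) ⟨P, hP⟩ i) ^ 2 = nP k P := rfl
  rw [h2, Fintype.sum_sum_type] at h1
  refine h1.trans ?_
  rw [mul_assoc]
  gcongr
  have h3 : ∀ a : Fin (k - 2), (((sumL (momL (k - 2)) endG) ∘ₗ S) ⟨P, hP⟩ (Sum.inl a)) ^ 2 ≤
      ∫ t in Ioo (0:ℝ) 1, (q t) ^ 2 := fun a =>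
    vem_mom_sq (fun t => P.eval t) q _ a (by omega) (by fun_prop) hq hr
  have h4 : ∑ a : Fin 2, (((sumL (momL (k - 2)) endG) ∘ₗ S) ⟨P, hP⟩ (Sum.inr a)) ^ 2 =
    ((P.eval 0) ^ 2 + (P.eval 1) ^ 2) := by
    simp [sumL, endG, Fin.sum_univ_two, S]
  rw [h4]
  have h5 := Finset.sum_le_sum (s := Finset.univ) fun a _ => h3 a
  rw [Finset.sum_const, Finset.card_univ, Fintype.card_fin, nsmul_eq_mul] at h5
  have h6 : ((k - 2 : ℕ) : ℝ) ≤ k := by exact_mod_cast Nat.sub_le k 2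
  have h7 : 0 ≤ ∫ t in Ioo (0:ℝ) 1, (q t) ^ 2 := integral_nonneg fun t => sq_nonneg _
  have h8 : 0 ≤ ((P.eval 0) ^ 2 + (P.eval 1) ^ 2) := by positivity
  have h9 : (0:ℝ) ≤ k := by positivity
  nlinarith [mul_nonneg h9 h8, mul_le_mul_of_nonneg_right h6 h7]

open Polynomial in
/-- pointwise bound by the coefficients -/
lemma vem_eval_sq_le (k : ℕ) (P : ℝ[X]) (hP : P ∈ degreeLE ℝ k) (t : ℝ) (ht : t ∈ Icc (0:ℝ) 1) :
    (P.eval t) ^ 2 ≤ (k + 1) * nP k P := by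
  have h1 : P.eval t = ∑ i : Fin (k + 1), t ^ (i : ℕ) * P.coeff i := by
    rw [Polynomial.eval_eq_sum_range' (n := k + 1) (by have := vem_natDegree_le hP; omega),
      Finset.sum_range]
    exact Finset.sum_congr rfl fun i _ => mul_comm _ _
  rw [h1]
  refine (Finset.sum_mul_sq_le_sq_mul_sq _ _ _).trans ?_
  refine mul_le_mul_of_nonneg_right ?_ (nP_nonneg k P)
  calc ∑ i : Fin (k + 1), (t ^ (i : ℕ)) ^ 2 ≤ ∑ i : Fin (k + 1), (1:ℝ) :=
        Finset.sum_le_sum fun i _ =>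
          pow_le_one₀ (pow_nonneg ht.1 _) (pow_le_one₀ ht.1 ht.2)
    _ = k + 1 := by simp

open Polynomial in
lemma vem_int_sq_le (k : ℕ) (P : ℝ[X]) (hP : P ∈ degreeLE ℝ k) :
    ∫ t in Ioo (0:ℝ) 1, (P.eval t) ^ 2 ≤ (k + 1) * nP k P := by
  have : ∫ t in Ioo (0:ℝ) 1, (P.eval t) ^ 2 ≤ ∫ t in Ioo (0:ℝ) 1, ((k + 1) * nP k P) := by
    refine setIntegral_mono_on (vem_cont_int _ (by fun_prop)) (vem_cont_int _ (by fun_prop))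
        measurableSet_Ioo fun t ht => vem_eval_sq_le k P hP t ⟨ht.1.le, ht.2.le⟩
  simpa using this

open Polynomial in
lemma vem_deriv_mem (k : ℕ) (P : ℝ[X]) (hP : P ∈ degreeLE ℝ k) :
    derivative P ∈ degreeLE ℝ k := by
  rw [mem_degreeLE] at *
  exact (degree_derivative_le).trans hP

open Polynomial in
lemma vem_nP_deriv (k : ℕ) (P : ℝ[X]) (hP : P ∈ degreeLE ℝ k) :
    nP k (derivative P) ≤ (k : ℝ) ^ 2 * nP k P := by
  unfold nP
  rw [Fin.sum_univ_castSucc, Fin.sum_univ_succ (n := k), mul_add, Finset.mul_sum]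
  have h0 : (derivative P).coeff (Fin.last k : ℕ) = 0 := by
    rw [coeff_derivative, coeff_eq_zero_of_natDegree_lt, zero_mul]
    have := vem_natDegree_le hP
    simp; omega
  rw [h0]
  have : ∀ i : Fin k, ((derivative P).coeff (i.castSucc : ℕ)) ^ 2
      ≤ (k : ℝ) ^ 2 * (P.coeff (i.succ : ℕ)) ^ 2 := by
    intro i
    rw [coeff_derivative, mul_pow, mul_comm]
    have : (((i.castSucc : Fin (k+1)) : ℕ) + 1 : ℝ) ≤ k := by
      have := i.2; simp only [Fin.val_castSucc]; exact_mod_cast this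
    simp only [Fin.val_succ, Fin.val_castSucc] at *
    gcongr
  have := Finset.sum_le_sum (s := Finset.univ) fun i _ => this i
  have : 0 ≤ (k:ℝ)^2 * (P.coeff ((0 : Fin (k+1)) : ℕ))^2 := by positivity
  simp only [ne_eq, OfNat.ofNat_ne_zero, not_false_eq_true, zero_pow, add_zero]
  linarith

open Polynomial in
lemma vem_nP_comb (k : ℕ) (P Q : ℝ[X]) (a b : ℝ) :
    nP k (a • P + b • Q) ≤ 2 * a ^ 2 * nP k P + 2 * b ^ 2 * nP k Q := by
  unfold nP
  rw [Finset.mul_sum, Finset.mul_sum, ← Finset.sum_add_distrib]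
  refine Finset.sum_le_sum fun i _ => ?_
  simp only [coeff_add, coeff_smul, smul_eq_mul]
  nlinarith [sq_nonneg (a * P.coeff i - b * Q.coeff i)]

open Polynomial in
lemma vem_isPoly_iff {m : ℕ} {u : ℝ → ℝ} (h : IsPolyDegLe (m : ℤ) u) :
    ∃ P : ℝ[X], P ∈ degreeLE ℝ m ∧ ∀ t, u t = P.eval t := by
  obtain ⟨Q, h1, h2⟩ := h
  refine ⟨Q, ?_, h2⟩
  rw [mem_degreeLE, degree_le_iff_coeff_zero]
  intro n hn
  exact h1 n (by exact_mod_cast hn)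

/-! ### Part B: geometry of triangles -/

def detp (p : Fin 3 → E2) : ℝ :=
  (p 1 - p 0) 0 * (p 2 - p 0) 1 - (p 1 - p 0) 1 * (p 2 - p 0) 0

def linp (p : Fin 3 → E2) : E2 →ₗ[ℝ] E2 where
  toFun x := x 0 • (p 1 - p 0) + x 1 • (p 2 - p 0)
  map_add' x y := by simp only [PiLp.add_apply, add_smul]; abel
  map_smul' c x := by
    simp only [PiLp.smul_apply, smul_eq_mul, mul_smul, smul_add, RingHom.id_apply]

lemma affMap_eq (p : Fin 3 → E2) (x : E2) : affMap p x = p 0 + linp p x := by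
  simp [affMap, linp, add_assoc]

lemma det_linp (p : Fin 3 → E2) : LinearMap.det (linp p) = detp p := by
  rw [← LinearMap.det_toMatrix (EuclideanSpace.basisFun (Fin 2) ℝ).toBasis, Matrix.det_fin_two]
  simp [LinearMap.toMatrix_apply, linp, detp]
  ring

def linpE (p : Fin 3 → E2) (h : 0 < detp p) : E2 ≃L[ℝ] E2 :=
  (LinearEquiv.ofIsUnitDet (f := linp p) (v := (EuclideanSpace.basisFun (Fin 2) ℝ).toBasis)
    (v' := (EuclideanSpace.basisFun (Fin 2) ℝ).toBasis) (by
      rw [LinearMap.det_toMatrix, det_linp]; exact h.ne'.isUnit)).toContinuousLinearEquiv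

lemma linpE_apply (p : Fin 3 → E2) (h : 0 < detp p) (x : E2) : linpE p h x = linp p x := rfl

def affH (p : Fin 3 → E2) (h : 0 < detp p) : E2 ≃ₜ E2 :=
  (linpE p h).toHomeomorph.trans (Homeomorph.addLeft (p 0))

lemma affH_apply (p : Fin 3 → E2) (h : 0 < detp p) (x : E2) : affH p h x = affMap p x := by
  rw [affMap_eq]; rfl

lemma coe_affH (p : Fin 3 → E2) (h : 0 < detp p) : ⇑(affH p h) = affMap p :=
  funext (affH_apply p h)

lemma affMap_ref (p : Fin 3 → E2) (i : Fin 3) : affMap p (refTri i) = p i := by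
  fin_cases i <;> simp [affMap, refTri]

lemma affMap_image_hull (p : Fin 3 → E2) :
    Set.image (affMap p) (convexHull ℝ (range refTri)) = convexHull ℝ (range p) := by
  let A : E2 →ᵃ[ℝ] E2 := (linp p).toAffineMap + AffineMap.const ℝ E2 (p 0)
  have hA : ⇑A = affMap p := by ext x; simp [A, affMap_eq, add_comm]
  rw [← hA, AffineMap.image_convexHull, ← range_comp]
  congr 2
  ext i
  simp [hA, affMap_ref]

lemma affMap_image_tri (p : Fin 3 → E2) (h : 0 < detp p) :
    Set.image (affMap p) (tri refTri) = tri p := by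
  unfold tri
  rw [← affMap_image_hull p, ← coe_affH p h, Homeomorph.image_interior]

lemma affMap_preimage_tri (p : Fin 3 → E2) (h : 0 < detp p) :
    affMap p ⁻¹' (tri p) = tri refTri := by
  rw [← affMap_image_tri p h, preimage_image_eq]
  rw [← coe_affH p h]; exact (affH p h).injective

lemma isOpen_tri (p : Fin 3 → E2) : IsOpen (tri p) := isOpen_interior

lemma isCompact_hull (p : Fin 3 → E2) : IsCompact (convexHull ℝ (range p)) :=
  (finite_range p).isCompact_convexHull (𝕜 := ℝ)

lemma tri_subset (p : Fin 3 → E2) : tri p ⊆ convexHull ℝ (range p) := interior_subset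

lemma tri_bdd (p : Fin 3 → E2) : Bornology.IsBounded (tri p) :=
  (isCompact_hull p).isBounded.subset (tri_subset p)

instance tri_finite (p : Fin 3 → E2) : IsFiniteMeasure (volume.restrict (tri p)) :=
  ⟨by rw [Measure.restrict_apply_univ]; exact (tri_bdd p).measure_lt_top⟩

lemma map_affMap (p : Fin 3 → E2) (h : 0 < detp p) :
    Measure.map (affMap p) (volume.restrict (tri refTri))
      = ENNReal.ofReal (detp p)⁻¹ • volume.restrict (tri p) := by
  have hemb : MeasurableEmbedding (affMap p) := by
    rw [← coe_affH p h]; exact (affH p h).measurableEmbedding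
  rw [← affMap_preimage_tri p h, ← hemb.restrict_map]
  have : Measure.map (affMap p) (volume : Measure E2)
      = ENNReal.ofReal (detp p)⁻¹ • volume := by
    have e : affMap p = (fun x => p 0 + x) ∘ linp p := funext (affMap_eq p)
    rw [e, ← Measure.map_map (measurable_const_add _)
      ((linp p).continuous_of_finiteDimensional.measurable),
      Measure.map_linearMap_addHaar_eq_smul_addHaar _ (by rw [det_linp]; exact h.ne'),
      Measure.map_smul, map_add_left_eq_self, det_linp, abs_of_pos (by positivity)]
  rw [this, Measure.restrict_smul]

lemma integral_affMap (p : Fin 3 → E2) (h : 0 < detp p) (F : E2 → ℝ) :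
    ∫ x in tri p, F x = detp p * ∫ x in tri refTri, F (affMap p x) := by
  have hemb : MeasurableEmbedding (affMap p) := by
    rw [← coe_affH p h]; exact (affH p h).measurableEmbedding
  rw [← hemb.integral_map, map_affMap p h, integral_smul_measure, ENNReal.toReal_ofReal (by positivity)]
  rw [smul_eq_mul, ← mul_assoc, mul_inv_cancel₀ h.ne', one_mul]

lemma L2on_affMap (p : Fin 3 → E2) (h : 0 < detp p) {u : E2 → ℝ} (hu : L2on (tri p) u) :
    L2on (tri refTri) (fun x => u (affMap p x)) := by
  have hemb : MeasurableEmbedding (affMap p) := by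
    rw [← coe_affH p h]; exact (affH p h).measurableEmbedding
  have := (hemb.memLp_map_measure_iff (μ := volume.restrict (tri refTri)) (g := u) (p := 2)).1 (by
    rw [map_affMap p h]
    exact hu.smul_measure ENNReal.ofReal_ne_top)
  exact this

/-! reference triangle -/

lemma ref_hull_sub : convexHull ℝ (range refTri) ⊆ {x : E2 | 0 ≤ x 0 ∧ 0 ≤ x 1 ∧ x 0 + x 1 ≤ 1} := by
  apply convexHull_min
  · rintro _ ⟨i, rfl⟩
    fin_cases i <;> simp [refTri]
  · intro x hx y hy a b ha hb hab
    obtain ⟨x0, x1, x2⟩ := hx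
    obtain ⟨y0, y1, y2⟩ := hy
    refine ⟨?_, ?_, ?_⟩
    · simp only [PiLp.add_apply, PiLp.smul_apply, smul_eq_mul]; positivity
    · simp only [PiLp.add_apply, PiLp.smul_apply, smul_eq_mul]; positivity
    · simp only [PiLp.add_apply, PiLp.smul_apply, smul_eq_mul]
      nlinarith [mul_le_mul_of_nonneg_left x2 ha, mul_le_mul_of_nonneg_left y2 hb]

lemma ref_tri_eq : tri refTri = {x : E2 | 0 < x 0 ∧ 0 < x 1 ∧ x 0 + x 1 < 1} := by
  apply Subset.antisymm
  · intro x hx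
    have hs : tri refTri ⊆ {x : E2 | 0 ≤ x 0 ∧ 0 ≤ x 1 ∧ x 0 + x 1 ≤ 1} :=
      (tri_subset _).trans ref_hull_sub
    obtain ⟨ε, hε, hb⟩ := Metric.isOpen_iff.1 (isOpen_tri refTri) x hx
    have key : ∀ v : E2, ‖v‖ ≤ 1 → x + (ε / 2) • v ∈ tri refTri := by
      intro v hv
      apply hb
      rw [Metric.mem_ball, dist_eq_norm, add_sub_cancel_left, norm_smul, Real.norm_eq_abs,
        abs_of_pos (by positivity)]
      nlinarith
    have h0 := (hs (key (-EuclideanSpace.single 0 1) (by simp))).1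
    have h1 := (hs (key (-EuclideanSpace.single 1 1) (by simp))).2.1
    have h2 := (hs (key (EuclideanSpace.single 1 1) (by simp))).2.2
    simp at h0 h1 h2
    refine ⟨by linarith, by linarith, by linarith⟩
  · apply interior_maximal
    · rintro x ⟨h0, h1, h2⟩
      have e : x = ∑ i : Fin 3, (![1 - x 0 - x 1, x 0, x 1] : Fin 3 → ℝ) i • refTri i := by
        rw [Fin.sum_univ_three]
        ext i; fin_cases i <;> simp [refTri]
      rw [e]
      apply (convex_convexHull ℝ _).sum_mem
      · intro i _; fin_cases i <;> simp <;> linarith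
      · rw [Fin.sum_univ_three]; simp; ring
      · intro i _; exact subset_convexHull _ _ (mem_range_self i)
    · have c0 : Continuous fun x : E2 => x 0 := by fun_prop
      have c1 : Continuous fun x : E2 => x 1 := by fun_prop
      exact (isOpen_lt continuous_const c0).inter ((isOpen_lt continuous_const c1).inter
        (isOpen_lt (c0.add c1) continuous_const))

lemma ref_edge_not_mem (j : Fin 3) (t : ℝ) : epar refTri j t ∉ tri refTri := by
  rw [ref_tri_eq]
  rintro ⟨h0, h1, h2⟩
  fin_cases j <;> simp [epar, refTri, evec] at h0 h1 h2

def cref : E2 := !₂[1/3, 1/3]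

lemma cref_mem : cref ∈ tri refTri := by
  rw [ref_tri_eq]; simp [cref]; norm_num

lemma tri_nonempty (p : Fin 3 → E2) (h : 0 < detp p) : (tri p).Nonempty := by
  rw [← affMap_image_tri p h]; exact ⟨_, mem_image_of_mem _ cref_mem⟩

lemma epar_affMap (p : Fin 3 → E2) (j : Fin 3) (t : ℝ) :
    affMap p (epar refTri j t) = epar p j t := by
  have : ∀ i, linp p (refTri i) = p i - p 0 := by
    intro i; rw [← affMap_ref p i, affMap_eq]; abel_nf
  rw [affMap_eq]
  simp only [epar, evec, map_add, map_smul, map_sub, this]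
  rw [sub_sub_sub_cancel_right]; abel

lemma diam_tri (p : Fin 3 → E2) (h : 0 < detp p) : Metric.diam (tri p) = Metric.diam (range p) := by
  rw [← convexHull_diam (range p), ← Metric.diam_closure (tri p),
    ← Metric.diam_closure (convexHull ℝ (range p))]
  unfold tri
  rw [(convex_convexHull ℝ _).closure_interior_eq_closure_of_nonempty_interior (tri_nonempty p h)]

lemma elen_le_diam (p : Fin 3 → E2) (h : 0 < detp p) (i : Fin 3) :
    elen p i ≤ Metric.diam (tri p) := by
  rw [diam_tri p h, elen, evec, ← dist_eq_norm]
  exact Metric.dist_le_diam_of_mem (finite_range p).isBounded (mem_range_self _) (mem_range_self _)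

lemma exists_diam_le (p : Fin 3 → E2) (h : 0 < detp p) :
    ∃ i, Metric.diam (tri p) ≤ elen p i := by
  obtain ⟨i, -, hi⟩ := Finset.exists_max_image (Finset.univ : Finset (Fin 3)) (elen p) ⟨0, by simp⟩
  refine ⟨i, ?_⟩
  rw [diam_tri p h]
  refine Metric.diam_le_of_forall_dist_le (norm_nonneg _) ?_
  have h0 := hi 0 (by simp)
  have h1 := hi 1 (by simp)
  have h2 := hi 2 (by simp)
  have hn : 0 ≤ elen p i := norm_nonneg _
  rintro _ ⟨a, rfl⟩ _ ⟨b, rfl⟩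
  have e0 : elen p 0 = dist (p 2) (p 1) := by rw [dist_eq_norm]; rfl
  have e1 : elen p 1 = dist (p 0) (p 2) := by rw [dist_eq_norm]; rfl
  have e2 : elen p 2 = dist (p 1) (p 0) := by rw [dist_eq_norm]; rfl
  fin_cases a <;> fin_cases b <;> simp only [Fin.zero_eta, Fin.mk_one, Fin.reduceFinMk, dist_self] <;>
    first | exact hn | linarith | (rw [dist_comm]; linarith)

def crs (u v : E2) : ℝ := u 0 * v 1 - u 1 * v 0

lemma norm_sq_E2 (u : E2) : ‖u‖ ^ 2 = u 0 ^ 2 + u 1 ^ 2 := by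
  rw [EuclideanSpace.norm_sq_eq, Fin.sum_univ_two]; simp

lemma inner_E2 (u v : E2) : ⟪u, v⟫ = u 0 * v 0 + u 1 * v 1 := by
  rw [PiLp.inner_apply, Fin.sum_univ_two]; simp; ring

lemma crs_sq (u v : E2) : crs u v ^ 2 + ⟪u, v⟫ ^ 2 = ‖u‖ ^ 2 * ‖v‖ ^ 2 := by
  rw [norm_sq_E2, norm_sq_E2, inner_E2, crs]; ring

lemma crs_le (u v : E2) : crs u v ≤ ‖u‖ * ‖v‖ := by
  refine le_of_abs_le (abs_le_of_sq_le_sq ?_ (by positivity))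
  rw [mul_pow]
  nlinarith [crs_sq u v, sq_nonneg ⟪u, v⟫]

lemma crs_ge (u v : E2) (m : ℝ) (h0 : 0 ≤ crs u v)
    (h : m ≤ Real.sin (InnerProductGeometry.angle u v)) : m * (‖u‖ * ‖v‖) ≤ crs u v := by
  have h1 := InnerProductGeometry.sin_angle_mul_norm_mul_norm u v
  have h2 : √(⟪u, u⟫ * ⟪v, v⟫ - ⟪u, v⟫ * ⟪u, v⟫) = crs u v := by
    rw [← Real.sqrt_sq h0]
    congr 1
    have := crs_sq u v
    rw [real_inner_self_eq_norm_sq, real_inner_self_eq_norm_sq]; linarith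
  rw [← h2, ← h1]
  gcongr


lemma crs_evec (p : Fin 3 → E2) (i : Fin 3) :
    crs (evec p (i + 2)) (-evec p (i + 1)) = detp p := by
  fin_cases i <;> simp [crs, evec, detp, show (1:Fin 3)+2 = 0 from rfl, show (2:Fin 3)+2 = 1 from rfl, show (2:Fin 3)+1 = 0 from rfl] <;> ring

lemma vem_shape (δ : ℝ) (hδ : 0 < δ) : ∃ m : ℝ, 0 < m ∧ m ≤ 1 ∧ ∀ p : Fin 3 → E2, 0 < detp p →
    MinAngleLB δ p → (∀ i, m * Metric.diam (tri p) ≤ elen p i) ∧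
      m * Metric.diam (tri p) ^ 2 ≤ detp p ∧ detp p ≤ Metric.diam (tri p) ^ 2 ∧
      0 < Metric.diam (tri p) := by
  have hs1 : 0 < min δ 1 := by positivity
  have hpi := Real.pi_gt_three
  have hs : 0 < Real.sin (min δ 1) :=
    Real.sin_pos_of_pos_of_lt_pi hs1 (by have := min_le_right δ 1; linarith)
  refine ⟨Real.sin (min δ 1) / 2, by positivity, by have := Real.sin_le_one (min δ 1); linarith, ?_⟩
  intro p hp hang
  set s := Real.sin (min δ 1) with hsdef
  set h := Metric.diam (tri p) with hh
  have hle := elen_le_diam p hp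
  obtain ⟨a, ha⟩ := exists_diam_le p hp
  have hpos : ∀ i, 0 ≤ elen p i := fun i => norm_nonneg _
  have hup : ∀ i : Fin 3, detp p ≤ elen p (i + 2) * elen p (i + 1) := by
    intro i
    have := crs_le (evec p (i + 2)) (-evec p (i + 1))
    rw [crs_evec, norm_neg] at this; exact this
  have hne : p 1 ≠ p 0 := by
    intro e; rw [detp, e] at hp; simp at hp
  have hsum := EuclideanGeometry.angle_add_angle_add_angle_eq_pi (p 2) hne
  have a0 : δ ≤ EuclideanGeometry.angle (p 1) (p 0) (p 2) := hang 0
  have a1 : δ ≤ EuclideanGeometry.angle (p 2) (p 1) (p 0) := hang 1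
  have a2 : δ ≤ EuclideanGeometry.angle (p 0) (p 2) (p 1) := hang 2
  rw [EuclideanGeometry.angle_comm (p 0) (p 1) (p 2), EuclideanGeometry.angle_comm (p 1) (p 2) (p 0), EuclideanGeometry.angle_comm (p 2) (p 0) (p 1)] at hsum
  have hsin : ∀ x, δ ≤ x → x ≤ π - δ → s ≤ Real.sin x := by
    intro x h1 h2
    have hmd := min_le_left δ 1
    have hm1 := min_le_right δ 1
    rcases le_total x (π / 2) with h3 | h3
    · exact Real.sin_le_sin_of_le_of_le_pi_div_two (by linarith) h3 (by linarith)
    · rw [← Real.sin_pi_sub x]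
      exact Real.sin_le_sin_of_le_of_le_pi_div_two (by linarith) (by linarith) (by linarith)
  have hsa : ∀ i : Fin 3, s ≤ Real.sin (EuclideanGeometry.angle (p (i + 1)) (p i) (p (i + 2))) := by
    intro i
    apply hsin _ (hang i)
    fin_cases i
    · change EuclideanGeometry.angle (p 1) (p 0) (p 2) ≤ _; linarith
    · change EuclideanGeometry.angle (p 2) (p 1) (p 0) ≤ _; linarith
    · change EuclideanGeometry.angle (p 0) (p 2) (p 1) ≤ _; linarith
  have hlow : ∀ i : Fin 3, s * (elen p (i + 2) * elen p (i + 1)) ≤ detp p := by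
    intro i
    have e1 : p (i + 1) -ᵥ p i = evec p (i + 2) := by
      fin_cases i <;> rfl
    have e2 : p (i + 2) -ᵥ p i = -evec p (i + 1) := by
      fin_cases i <;> simp [evec, show (2:Fin 3)+2 = 1 from rfl, show (1:Fin 3)+2 = 0 from rfl, show (2:Fin 3)+1 = 0 from rfl]
    have h1 := hsa i
    unfold EuclideanGeometry.angle at h1
    rw [e1, e2] at h1
    have := crs_ge _ _ s (by rw [crs_evec]; exact hp.le) h1
    rwa [crs_evec, norm_neg] at this
  have htri : h ≤ elen p (a + 1) + elen p (a + 2) := by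
    refine ha.trans ?_
    have : evec p a = -(evec p (a + 1) + evec p (a + 2)) := by
      fin_cases a <;> simp [evec, show (2:Fin 3)+2 = 1 from rfl, show (1:Fin 3)+2 = 0 from rfl, show (2:Fin 3)+1 = 0 from rfl]
    unfold elen
    rw [this, norm_neg]; exact norm_add_le _ _
  have l1 : s * (elen p a * elen p (a + 2)) ≤ detp p := by
    have := hlow (a + 1)
    have e1 : a + 1 + 2 = a := by fin_cases a <;> rfl
    have e2 : a + 1 + 1 = a + 2 := by fin_cases a <;> rfl
    rwa [e1, e2] at this
  have l2 : s * (elen p (a + 1) * elen p a) ≤ detp p := by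
    have := hlow (a + 2)
    have e1 : a + 2 + 2 = a + 1 := by fin_cases a <;> rfl
    have e2 : a + 2 + 1 = a := by fin_cases a <;> rfl
    rwa [e1, e2] at this
  have hea : elen p a = h := le_antisymm (hle a) ha
  rw [hea] at l1 l2
  have hh0 : 0 ≤ h := Metric.diam_nonneg
  have hD : s / 2 * h ^ 2 ≤ detp p := by
    have := mul_le_mul_of_nonneg_left htri (mul_nonneg hs.le hh0)
    nlinarith
  have hDu : detp p ≤ h ^ 2 := by
    refine (hup 0).trans ?_
    rw [pow_two]
    exact mul_le_mul (hle _) (hle _) (hpos _) hh0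
  have hhp : 0 < h := by
    by_contra hc
    have : h = 0 := by linarith
    rw [this] at hDu; norm_num at hDu; linarith
  refine ⟨fun i => ?_, hD, hDu, hhp⟩
  have h1 := hup (i + 1)
  have e1 : i + 1 + 2 = i := by fin_cases i <;> rfl
  rw [e1] at h1
  have h2 := mul_le_mul_of_nonneg_left (hle (i + 1 + 1)) (hpos i)
  have h3 : s / 2 * h * h ≤ elen p i * h := by nlinarith
  exact le_of_mul_le_mul_right h3 hhp

/-! ### Part C: face traces -/

lemma cont_L2on (p : Fin 3 → E2) {ψ : E2 → ℝ} (h : Continuous ψ) : L2on (tri p) ψ := by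
  unfold L2on
  rw [memLp_two_iff_integrable_sq h.aestronglyMeasurable]
  exact ((h.pow 2).continuousOn.integrableOn_compact (isCompact_hull p)).mono_set (tri_subset p)

lemma L2on_int {p : Fin 3 → E2} {u ψ : E2 → ℝ} (hu : L2on (tri p) u) (h : Continuous ψ) :
    Integrable (fun x => u x * ψ x) (volume.restrict (tri p)) :=
  hu.integrable_mul (cont_L2on p h)

lemma cont_dd {φ : E2 → ℝ} (hφ : ContDiff ℝ (⊤ : ℕ∞) φ) (v : E2) :
    Continuous fun x => fderiv ℝ φ x v :=
  (hφ.continuous_fderiv (by simp)).clm_apply continuous_const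

lemma contDiff_dd {φ : E2 → ℝ} (hφ : ContDiff ℝ (⊤ : ℕ∞) φ) (v : E2) :
    ContDiff ℝ (⊤ : ℕ∞) fun x => fderiv ℝ φ x v :=
  (hφ.fderiv_right (m := (⊤ : ℕ∞)) (by simp)).clm_apply contDiff_const

lemma elen_norv0 (p : Fin 3 → E2) (j : Fin 3) : elen p j * norv p j 0 = evec p j 1 := by
  by_cases h : elen p j = 0
  · have : evec p j = 0 := norm_eq_zero.1 h
    simp [h, this]
  · simp [norv, tangv, h]

lemma elen_norv1 (p : Fin 3 → E2) (j : Fin 3) : elen p j * norv p j 1 = -evec p j 0 := by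
  by_cases h : elen p j = 0
  · have : evec p j = 0 := norm_eq_zero.1 h
    simp [h, this]
  · simp [norv, tangv, h]

lemma evec_linp (p : Fin 3 → E2) (j : Fin 3) : evec p j = linp p (evec refTri j) := by
  have h1 := epar_affMap p j 1
  have h0 := epar_affMap p j 0
  simp only [affMap_eq, epar, one_smul, zero_smul, add_zero, map_add] at h0 h1
  rw [← h0] at h1
  have := h1.symm
  rw [← add_assoc] at this
  exact add_left_cancel this

lemma crs_linp (p : Fin 3 → E2) (u v : E2) : crs (linp p u) (linp p v) = detp p * crs u v := by
  simp [crs, linp, detp]; ring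

/-- directional form of the face trace relation -/
lemma faceTrace_dir {p : Fin 3 → E2} {u : E2 → ℝ} {Du : Fin 2 → E2 → ℝ} {b : Fin 3 → ℝ → ℝ}
    (hu : L2on (tri p) u) (hD : ∀ d, L2on (tri p) (Du d)) (H : HasFaceTrace p u Du b)
    {φ : E2 → ℝ} (hφ : ContDiff ℝ (⊤ : ℕ∞) φ) (hc : HasCompactSupport φ) (v : E2) :
    ∫ x in tri p, (u x * fderiv ℝ φ x v + (∑ i, v i * Du i x) * φ x)
      = ∑ j : Fin 3, crs v (evec p j) * ∫ t in Ioo (0:ℝ) 1, b j t * φ (epar p j t) := by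
  have H0 := H φ hφ hc 0
  have H1 := H φ hφ hc 1
  have hv : v = v 0 • stdb2 0 + v 1 • stdb2 1 := by
    ext i; fin_cases i <;> simp [stdb2]
  have e : ∀ x, u x * fderiv ℝ φ x v + (∑ i, v i * Du i x) * φ x
      = v 0 * (u x * fderiv ℝ φ x (stdb2 0) + Du 0 x * φ x)
        + v 1 * (u x * fderiv ℝ φ x (stdb2 1) + Du 1 x * φ x) := by
    intro x
    conv_lhs => rw [hv]
    rw [map_add, map_smul, map_smul, Fin.sum_univ_two, ← hv]
    simp only [smul_eq_mul]; ring
  have hi : ∀ d, Integrable (fun x => u x * fderiv ℝ φ x (stdb2 d) + Du d x * φ x)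
      (volume.restrict (tri p)) := fun d =>
    (L2on_int hu (cont_dd hφ _)).add (L2on_int (hD d) hφ.continuous)
  simp_rw [e]
  rw [integral_add ((hi 0).const_mul _) ((hi 1).const_mul _), integral_const_mul,
    integral_const_mul, H0, H1, Finset.mul_sum, Finset.mul_sum, ← Finset.sum_add_distrib]
  refine Finset.sum_congr rfl fun j _ => ?_
  rw [integral_mul_const, integral_mul_const]
  have a0 := elen_norv0 p j
  have a1 := elen_norv1 p j
  rw [crs]
  linear_combination (v 0 * ∫ t in Ioo (0:ℝ) 1, b j t * φ (epar p j t)) * a0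
    + (v 1 * ∫ t in Ioo (0:ℝ) 1, b j t * φ (epar p j t)) * a1

lemma faceTrace_of_dir {p : Fin 3 → E2} {u : E2 → ℝ} {Du : Fin 2 → E2 → ℝ} {b : Fin 3 → ℝ → ℝ}
    (H : ∀ φ : E2 → ℝ, ContDiff ℝ (⊤ : ℕ∞) φ → HasCompactSupport φ → ∀ d : Fin 2,
      ∫ x in tri p, (u x * fderiv ℝ φ x (stdb2 d) + Du d x * φ x)
      = ∑ j : Fin 3, crs (stdb2 d) (evec p j) * ∫ t in Ioo (0:ℝ) 1, b j t * φ (epar p j t)) :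
    HasFaceTrace p u Du b := by
  intro φ hφ hc d
  rw [H φ hφ hc d]
  refine Finset.sum_congr rfl fun j _ => ?_
  rw [integral_mul_const]
  have a0 := elen_norv0 p j
  have a1 := elen_norv1 p j
  fin_cases d
  · simp only [crs, stdb2, Fin.zero_eta, PiLp.single_apply] at *
    simp only [if_true, one_ne_zero, if_false]
    linear_combination -(∫ t in Ioo (0:ℝ) 1, b j t * φ (epar p j t)) * a0
  · simp only [crs, stdb2, Fin.mk_one, PiLp.single_apply] at *
    simp only [if_true, zero_ne_one, if_false]
    linear_combination -(∫ t in Ioo (0:ℝ) 1, b j t * φ (epar p j t)) * a1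

lemma faceTrace_pull {p : Fin 3 → E2} (h : 0 < detp p) {u : E2 → ℝ} {Du : Fin 2 → E2 → ℝ}
    {b : Fin 3 → ℝ → ℝ}
    (hu : L2on (tri p) u) (hD : ∀ d, L2on (tri p) (Du d)) (H : HasFaceTrace p u Du b) :
    HasFaceTrace refTri (fun x => u (affMap p x))
      (fun d x => ∑ i, (linp p (stdb2 d)) i * Du i (affMap p x)) b := by
  apply faceTrace_of_dir
  intro φ hφ hc d
  set φ' : E2 → ℝ := fun y => φ ((affH p h).symm y) with hφ'
  have hsymm : ∀ y, (affH p h).symm y = (linpE p h).symm (y - p 0) := by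
    intro y
    rw [Homeomorph.symm_apply_eq, affH_apply, affMap_eq, ← linpE_apply p h]; simp
  have hφ's : ContDiff ℝ (⊤ : ℕ∞) φ' := by
    have : φ' = fun y => φ ((linpE p h).symm (y - p 0)) := by
      ext y; rw [hφ']; simp only [hsymm]
    rw [this]
    exact hφ.comp ((linpE p h).symm.contDiff.comp (contDiff_id.sub contDiff_const))
  have hφ'c : HasCompactSupport φ' := hc.comp_homeomorph (affH p h).symm
  have hcomp : ∀ x, φ' (affMap p x) = φ x := by
    intro x; rw [hφ']; simp only [← affH_apply p h, Homeomorph.symm_apply_apply]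
  have hder : ∀ x v, fderiv ℝ φ x v = fderiv ℝ φ' (affMap p x) (linp p v) := by
    intro x v
    have e : φ = φ' ∘ affMap p := funext fun x => (hcomp x).symm
    have hA : HasFDerivAt (affMap p) (linpE p h : E2 →L[ℝ] E2) x := by
      have : affMap p = fun x => p 0 + (linpE p h : E2 →L[ℝ] E2) x := funext (affMap_eq p)
      rw [this]
      exact ((linpE p h : E2 →L[ℝ] E2).hasFDerivAt).const_add _
    have := ((hφ's.differentiable (by simp)) (affMap p x)).hasFDerivAt.comp x hA
    conv_lhs => rw [e, this.fderiv]
    rfl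
  have key := faceTrace_dir hu hD H hφ's hφ'c (linp p (stdb2 d))
  rw [integral_affMap p h] at key
  have e2 : ∀ j, crs (linp p (stdb2 d)) (evec p j) * ∫ t in Ioo (0:ℝ) 1, b j t * φ' (epar p j t)
      = detp p * (crs (stdb2 d) (evec refTri j) *
        ∫ t in Ioo (0:ℝ) 1, b j t * φ (epar refTri j t)) := by
    intro j
    rw [evec_linp p j, crs_linp, mul_assoc]
    congr 3
    ext t
    rw [← epar_affMap, hcomp]
  rw [Finset.sum_congr rfl fun j _ => e2 j, ← Finset.mul_sum] at key
  have key' := mul_left_cancel₀ h.ne' key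
  rw [← key']
  congr 1
  ext x
  rw [hder, hcomp]

lemma faceTrace_comb {p : Fin 3 → E2} {u u' : E2 → ℝ} {Du Du' : Fin 2 → E2 → ℝ}
    {b b' : Fin 3 → ℝ → ℝ} (a c : ℝ)
    (hu : L2on (tri p) u) (hD : ∀ d, L2on (tri p) (Du d))
    (hu' : L2on (tri p) u') (hD' : ∀ d, L2on (tri p) (Du' d))
    (hb : ∀ j, Continuous (b j)) (hb' : ∀ j, Continuous (b' j))
    (H : HasFaceTrace p u Du b) (H' : HasFaceTrace p u' Du' b') :
    HasFaceTrace p (fun x => a * u x + c * u' x) (fun d x => a * Du d x + c * Du' d x)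
      (fun j t => a * b j t + c * b' j t) := by
  intro φ hφ hc d
  have h1 := H φ hφ hc d
  have h2 := H' φ hφ hc d
  have i1 : Integrable (fun x => u x * fderiv ℝ φ x (stdb2 d) + Du d x * φ x)
      (volume.restrict (tri p)) :=
    (L2on_int hu (cont_dd hφ _)).add (L2on_int (hD d) hφ.continuous)
  have i2 : Integrable (fun x => u' x * fderiv ℝ φ x (stdb2 d) + Du' d x * φ x)
      (volume.restrict (tri p)) :=
    (L2on_int hu' (cont_dd hφ _)).add (L2on_int (hD' d) hφ.continuous)
  have e : ∀ x, (a * u x + c * u' x) * fderiv ℝ φ x (stdb2 d) + (a * Du d x + c * Du' d x) * φ x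
      = a * (u x * fderiv ℝ φ x (stdb2 d) + Du d x * φ x)
        + c * (u' x * fderiv ℝ φ x (stdb2 d) + Du' d x * φ x) := fun x => by ring
  simp_rw [e]
  rw [integral_add (i1.const_mul _) (i2.const_mul _), integral_const_mul, integral_const_mul, h1, h2,
    Finset.mul_sum, Finset.mul_sum, ← Finset.sum_add_distrib]
  refine Finset.sum_congr rfl fun j _ => ?_
  have ce : Continuous (epar p j) := by unfold epar; fun_prop
  have e' : ∀ t, (a * b j t + c * b' j t) * φ (epar p j t) * norv p j d
      = a * (b j t * φ (epar p j t) * norv p j d) + c * (b' j t * φ (epar p j t) * norv p j d) :=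
    fun t => by ring
  have cφ := hφ.continuous
  have c1 := hb j
  have c2 := hb' j
  simp_rw [e']
  rw [integral_add (vem_cont_int _ (by fun_prop)) (vem_cont_int _ (by fun_prop)),
    integral_const_mul, integral_const_mul]
  ring

/-- the face trace relation for test functions without compact support -/
lemma faceTrace_smooth {p : Fin 3 → E2} {u : E2 → ℝ} {Du : Fin 2 → E2 → ℝ} {b : Fin 3 → ℝ → ℝ}
    (H : HasFaceTrace p u Du b)
    {φ : E2 → ℝ} (hφ : ContDiff ℝ (⊤ : ℕ∞) φ) (d : Fin 2) :
    ∫ x in tri p, (u x * fderiv ℝ φ x (stdb2 d) + Du d x * φ x)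
      = ∑ j : Fin 3, elen p j * ∫ t in Ioo (0:ℝ) 1, b j t * φ (epar p j t) * norv p j d := by
  obtain ⟨R, hR⟩ := (isCompact_hull p).isBounded.subset_ball (0 : E2)
  let χ : ContDiffBump (0 : E2) := ⟨max R 1, max R 1 + 1, by positivity, by linarith⟩
  have hχ : ContDiff ℝ (⊤ : ℕ∞) (fun x => φ x * χ x) := hφ.mul χ.contDiff
  have hloc : ∀ x ∈ convexHull ℝ (range p), (fun x => φ x * χ x) =ᶠ[nhds x] φ := by
    intro x hx
    have hx' : x ∈ Metric.ball (0 : E2) χ.rIn :=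
      Metric.ball_subset_ball (le_max_left _ _) (hR hx)
    filter_upwards [Metric.isOpen_ball.mem_nhds hx'] with y hy
    rw [χ.one_of_mem_closedBall (Metric.ball_subset_closedBall hy), mul_one]
  have h := H _ hχ (χ.hasCompactSupport.mul_left) d
  have e1 : ∫ x in tri p, (u x * fderiv ℝ (fun x => φ x * χ x) x (stdb2 d) + Du d x * (φ x * χ x))
      = ∫ x in tri p, (u x * fderiv ℝ φ x (stdb2 d) + Du d x * φ x) := by
    refine setIntegral_congr_fun (isOpen_tri p).measurableSet fun x hx => ?_
    have := hloc x (tri_subset p hx)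
    rw [this.fderiv_eq, this.eq_of_nhds]
  rw [← e1, h]
  refine Finset.sum_congr rfl fun j _ => ?_
  congr 1
  refine setIntegral_congr_fun measurableSet_Ioo fun t ht => ?_
  have hm : epar p j t ∈ convexHull ℝ (range p) := by
    have : epar p j t = (1 - t) • p (j + 1) + t • p (j + 2) := by
      simp only [epar, evec, smul_sub, sub_smul, one_smul]; abel
    rw [this]
    exact convex_convexHull ℝ _ (subset_convexHull _ _ (mem_range_self _))
      (subset_convexHull _ _ (mem_range_self _)) (by linarith [ht.2]) ht.1.le (by ring)
  have := hloc _ hm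
  simp only
  rw [this.eq_of_nhds]

/-- interior test functions vanish on the edges -/
lemma test_edge {φ : E2 → ℝ} (h : tsupport φ ⊆ tri refTri) (j : Fin 3) (t : ℝ) :
    φ (epar refTri j t) = 0 := by
  by_contra hc
  exact ref_edge_not_mem j t (h (subset_tsupport _ hc))

/-- a function whose weak derivative against interior test functions vanishes -/
lemma ae_zero_of_test {Du : E2 → ℝ} (hD : L2on (tri refTri) Du)
    (h : ∀ φ : E2 → ℝ, ContDiff ℝ (⊤ : ℕ∞) φ → HasCompactSupport φ → tsupport φ ⊆ tri refTri →
      ∫ x in tri refTri, Du x * φ x = 0) :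
    Du =ᵐ[volume.restrict (tri refTri)] 0 := by
  have h1 : IntegrableOn Du (tri refTri) volume := hD.integrable one_le_two
  have := (isOpen_tri refTri).ae_eq_zero_of_integral_contDiff_smul_eq_zero (f := Du)
    (μ := volume) h1.locallyIntegrableOn (by
      intro g hg hc hs
      have e := h g hg hc hs
      rw [← integral_indicator (isOpen_tri refTri).measurableSet] at e
      rw [← e]
      congr 1
      ext x
      by_cases hx : x ∈ tri refTri
      · rw [indicator_of_mem hx, smul_eq_mul, mul_comm]
      · rw [indicator_of_notMem hx]
        have : g x = 0 := by
          by_contra hc'; exact hx (hs (subset_tsupport _ hc'))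
        simp [this])
  exact (ae_restrict_iff' (isOpen_tri refTri).measurableSet).2 this

def lam (i : Fin 3) (x : E2) : ℝ := (![1 - x 0 - x 1, x 0, x 1] : Fin 3 → ℝ) i

lemma lam_contDiff (i : Fin 3) : ContDiff ℝ (⊤ : ℕ∞) (lam i) := by
  have c0 : ContDiff ℝ (⊤ : ℕ∞) fun x : E2 => x 0 := by fun_prop
  have c1 : ContDiff ℝ (⊤ : ℕ∞) fun x : E2 => x 1 := by fun_prop
  fin_cases i
  · exact (contDiff_const.sub c0).sub c1
  · exact c0
  · exact c1

lemma lam_edge0 (j : Fin 3) (t : ℝ) : lam j (epar refTri j t) = 0 := by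
  fin_cases j <;> simp [lam, epar, refTri, evec]

lemma lam_edge1 (j : Fin 3) (t : ℝ) : lam (j + 1) (epar refTri j t) = 1 - t := by
  fin_cases j <;> simp [lam, epar, refTri, evec, show (2:Fin 3)+2 = 1 from rfl,
    show (1:Fin 3)+2 = 0 from rfl, show (2:Fin 3)+1 = 0 from rfl] <;> ring

lemma lam_edge2 (j : Fin 3) (t : ℝ) : lam (j + 2) (epar refTri j t) = t := by
  fin_cases j <;> simp [lam, epar, refTri, evec, show (2:Fin 3)+2 = 1 from rfl,
    show (1:Fin 3)+2 = 0 from rfl, show (2:Fin 3)+1 = 0 from rfl]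

lemma ref_norv (j : Fin 3) : ∃ d, elen refTri j * norv refTri j d ≠ 0 := by
  fin_cases j
  · refine ⟨0, ?_⟩; rw [elen_norv0]; simp [evec, refTri]
  · refine ⟨0, ?_⟩; rw [elen_norv0]; simp [evec, refTri]
  · refine ⟨1, ?_⟩; rw [elen_norv1]; simp [evec, refTri, show (2:Fin 3)+2 = 1 from rfl, show (2:Fin 3)+1 = 0 from rfl]

open Polynomial in
/-- uniqueness of the trace -/
lemma trace_unique {u : E2 → ℝ} {Du : Fin 2 → E2 → ℝ} (B : Fin 3 → ℝ[X])
    (hu : u =ᵐ[volume.restrict (tri refTri)] 0) (hD : ∀ d, L2on (tri refTri) (Du d))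
    (H : HasFaceTrace refTri u Du (fun j t => (B j).eval t)) :
    (∀ d, Du d =ᵐ[volume.restrict (tri refTri)] 0) ∧ ∀ j, B j = 0 := by
  have hu0 : ∀ (φ : E2 → ℝ) (d : Fin 2),
      ∫ x in tri refTri, (u x * fderiv ℝ φ x (stdb2 d) + Du d x * φ x)
        = ∫ x in tri refTri, Du d x * φ x := by
    intro φ d
    refine integral_congr_ae ?_
    filter_upwards [hu] with x hx
    simp [hx]
  have hD0 : ∀ d, Du d =ᵐ[volume.restrict (tri refTri)] 0 := by
    intro d
    refine ae_zero_of_test (hD d) fun φ hφ hc hs => ?_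
    have := H φ hφ hc d
    rw [hu0] at this
    rw [this]
    simp [test_edge hs]
  refine ⟨hD0, fun j => ?_⟩
  obtain ⟨d, hd⟩ := ref_norv j
  have hpc : ContDiff ℝ (⊤ : ℕ∞) fun t : ℝ => (B j).eval t := by
    have := Polynomial.contDiff_aeval (𝕜 := ℝ) (B j) (⊤ : ℕ∞)
    simpa [Polynomial.coe_aeval_eq_eval] using this
  have hφ : ContDiff ℝ (⊤ : ℕ∞) fun x => lam (j + 1) x * lam (j + 2) x * (B j).eval (lam (j + 2) x) :=
    ((lam_contDiff _).mul (lam_contDiff _)).mul (hpc.comp (lam_contDiff _))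
  have := faceTrace_smooth H hφ d
  rw [hu0] at this
  have hz : ∫ x in tri refTri, Du d x * (lam (j + 1) x * lam (j + 2) x * (B j).eval (lam (j + 2) x)) = 0 := by
    rw [← integral_zero E2 ℝ (μ := volume.restrict (tri refTri))]
    refine integral_congr_ae ?_
    filter_upwards [hD0 d] with x hx
    simp [hx]
  rw [hz] at this
  have hsum : ∀ i, i ≠ j → ∀ t, lam (j + 1) (epar refTri i t) * lam (j + 2) (epar refTri i t) = 0 := by
    intro i hi t
    have : i = j + 1 ∨ i = j + 2 := by
      clear * - hi; revert i j; decide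
    rcases this with rfl | rfl
    · rw [lam_edge0, zero_mul]
    · rw [lam_edge0, mul_zero]
  rw [Finset.sum_eq_single j (by
    intro i _ hi
    simp [hsum i hi]) (by simp)] at this
  rw [integral_mul_const] at this
  have h3 : (elen refTri j * norv refTri j d) * ∫ t in Ioo (0:ℝ) 1, (B j).eval t *
      (lam (j + 1) (epar refTri j t) * lam (j + 2) (epar refTri j t) *
        (B j).eval (lam (j + 2) (epar refTri j t))) = 0 := by
    linarith [this]
  have h4 := (mul_eq_zero.1 h3).resolve_left hd
  apply vem_poly_zero (X * (1 - X)) (B j)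
  · intro t ht
    simp only [eval_mul, eval_X, eval_sub, eval_one]
    exact mul_pos ht.1 (by linarith [ht.2])
  · refine Eq.trans ?_ h4
    congr 1
    ext t
    rw [lam_edge1, lam_edge2]
    simp only [eval_mul, eval_X, eval_sub, eval_one]
    ring

/-! ### Part D: biharmonic functions with zero data -/

lemma map_dil (a : ℝ) (ha : 0 < a) (w : E2) :
    Measure.map (fun y : E2 => a • y - w) volume = ENNReal.ofReal ((a ^ 2)⁻¹) • volume := by
  have h1 : Measure.map (fun y : E2 => a • y) volume = ENNReal.ofReal ((a ^ 2)⁻¹) • volume := by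
    rw [Measure.map_addHaar_smul volume ha.ne']
    simp [abs_of_pos ha]
  have h2 : (fun y : E2 => a • y - w) = (fun y => y - w) ∘ (fun y : E2 => a • y) := rfl
  rw [h2, ← Measure.map_map (by fun_prop) (by fun_prop), h1, Measure.map_smul,
    (measurePreserving_sub_right volume w).map_eq]

lemma dil_memLp {v : E2 → ℝ} (hv : MemLp v 2 volume) (a : ℝ) (ha : 0 < a) (w : E2) :
    MemLp (fun y => v (a • y - w)) 2 volume := by
  have h1 : MemLp v 2 (Measure.map (fun y : E2 => a • y - w) volume) := by
    rw [map_dil a ha w]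
    exact hv.smul_measure ENNReal.ofReal_ne_top
  exact (memLp_map_measure_iff h1.1 (by fun_prop)).1 h1

lemma dil_integral (v : E2 → ℝ) (a : ℝ) (ha : 0 < a) (w : E2) :
    ∫ y, v (a • y - w) = (a ^ 2)⁻¹ * ∫ y, v y := by
  rw [Measure.integral_comp_smul volume (fun y => v (y - w)) a, integral_sub_right_eq_self v w]
  simp [abs_of_pos ha]

/-- continuity of the correlation under dilations and translations -/
lemma corr_tendsto {u v : E2 → ℝ} (hu : MemLp u 2 volume) (hu1 : Integrable u volume)
    (hv : MemLp v 2 volume) {ε : ℝ} (hε : 0 < ε) :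
    ∃ η > 0, ∀ (a : ℝ) (w : E2), |a - 1| < η → ‖w‖ < η →
      |(∫ y, u y * v (a • y - w)) - ∫ y, u y * v y| ≤ ε := by
  set U := ∫ y, (u y) ^ 2 with hU
  have hU0 : 0 ≤ U := integral_nonneg fun y => sq_nonneg _
  set e1 : ℝ := (ε / 4) ^ 2 / (4 * (U + 1)) with he1
  have he1p : 0 < e1 := by positivity
  obtain ⟨h, hc, hle, hcont, hmem⟩ :=
    MemLp.exists_hasCompactSupport_integral_rpow_sub_le (p := 2) (by norm_num)
      (by simpa using hv) he1p
  have hmem : MemLp h 2 volume := by simpa using hmem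
  have hle : ∫ y, (v y - h y) ^ 2 ≤ e1 := by
    refine le_trans (le_of_eq ?_) hle
    congr 1; ext y
    rw [Real.rpow_two, Real.norm_eq_abs, sq_abs]
  have hd : MemLp (fun y => v y - h y) 2 volume := hv.sub hmem
  have hbd : ∀ (a : ℝ) (w : E2), 1 / 2 ≤ a →
      |∫ y, u y * (v (a • y - w) - h (a • y - w))| ≤ ε / 4 := by
    intro a w ha
    have ha0 : 0 < a := by linarith
    have hcs := vem_cs hu (dil_memLp hd a ha0 w)
    rw [dil_integral (fun y => (v y - h y) ^ 2) a ha0 w] at hcs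
    have h4 : (a ^ 2)⁻¹ ≤ 4 := by
      rw [inv_le_comm₀ (by positivity) (by norm_num)]; nlinarith
    have hn : 0 ≤ ∫ y, (v y - h y) ^ 2 := integral_nonneg fun y => sq_nonneg _
    have : U * ((a ^ 2)⁻¹ * ∫ y, (v y - h y) ^ 2) ≤ (ε / 4) ^ 2 := by
      calc U * ((a ^ 2)⁻¹ * ∫ y, (v y - h y) ^ 2) ≤ (U + 1) * (4 * e1) := by
            gcongr; linarith
        _ = (ε / 4) ^ 2 := by rw [he1]; field_simp
    exact abs_le_of_sq_le_sq (hcs.trans this) (by positivity)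
  obtain ⟨M, hM⟩ := hcont.bounded_above_of_compact_support hc
  have ht : Filter.Tendsto (fun q : ℝ × E2 => ∫ y, u y * h (q.1 • y - q.2)) (nhds (1, 0))
      (nhds (∫ y, u y * h y)) := by
    refine tendsto_integral_filter_of_dominated_convergence (fun y => ‖u y‖ * M) ?_ ?_
      (hu1.norm.mul_const _) ?_
    · refine Filter.Eventually.of_forall fun q => ?_
      exact hu.1.mul (by fun_prop : Continuous fun y => h (q.1 • y - q.2)).aestronglyMeasurable
    · refine Filter.Eventually.of_forall fun q => Filter.Eventually.of_forall fun y => ?_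
      rw [norm_mul]
      gcongr
      exact hM _
    · refine Filter.Eventually.of_forall fun y => ?_
      have : Continuous fun q : ℝ × E2 => u y * h (q.1 • y - q.2) := by fun_prop
      have := this.tendsto (1, 0)
      simpa using this
  rw [Metric.tendsto_nhds_nhds] at ht
  obtain ⟨η, hη, H⟩ := ht (ε / 4) (by positivity)
  refine ⟨min η (1 / 2), by positivity, fun a w ha hw => ?_⟩
  have ha1 : |a - 1| < η := lt_of_lt_of_le ha (min_le_left _ _)
  have ha2 : |a - 1| < 1 / 2 := lt_of_lt_of_le ha (min_le_right _ _)
  have ha3 : 1 / 2 ≤ a := by linarith [(abs_lt.1 ha2).1]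
  have hq : dist ((a, w) : ℝ × E2) (1, 0) < η := by
    rw [Prod.dist_eq, max_lt_iff]
    refine ⟨by simpa [Real.dist_eq] using ha1, ?_⟩
    simpa using lt_of_lt_of_le hw (min_le_left _ _)
  have h1 := H hq
  rw [Real.dist_eq] at h1
  have h2 := hbd a w ha3
  have h3 := hbd 1 0 (by norm_num)
  simp only [one_smul, sub_zero] at h3
  have e2 : ∫ y, u y * (v (a • y - w) - h (a • y - w))
      = (∫ y, u y * v (a • y - w)) - ∫ y, u y * h (a • y - w) := by
    refine Eq.trans ?_ (integral_sub (hu.integrable_mul (dil_memLp hv a (by linarith) w))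
      (hu.integrable_mul (dil_memLp hmem a (by linarith) w)))
    congr 1; ext y; ring
  have e3 : ∫ y, u y * (v y - h y) = (∫ y, u y * v y) - ∫ y, u y * h y := by
    refine Eq.trans ?_ (integral_sub (hu.integrable_mul hv) (hu.integrable_mul hmem))
    congr 1; ext y; ring
  rw [e2] at h2
  rw [e3] at h3
  rw [abs_le] at *
  have := abs_lt.1 h1
  constructor <;> linarith [this.1, this.2, h2.1, h2.2, h3.1, h3.2]

/-- convolution, in the form `∫ v z * θ (x - z)` -/
def cv (v θ : E2 → ℝ) (x : E2) : ℝ := ∫ z, v z * θ (x - z)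

lemma cv_eq (v θ : E2 → ℝ) : cv v θ = convolution v θ (ContinuousLinearMap.mul ℝ ℝ) volume := by
  ext x; simp [cv, convolution]

lemma cv_contDiff {v θ : E2 → ℝ} (hv : Integrable v volume) (hθ : ContDiff ℝ (⊤ : ℕ∞) θ)
    (hc : HasCompactSupport θ) : ContDiff ℝ (⊤ : ℕ∞) (cv v θ) := by
  rw [cv_eq]
  exact hc.contDiff_convolution_right _ hv.locallyIntegrable hθ

lemma cv_fderiv {v θ : E2 → ℝ} (hv : Integrable v volume) (hθ : ContDiff ℝ (⊤ : ℕ∞) θ)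
    (hc : HasCompactSupport θ) (d : E2) :
    (fun x => fderiv ℝ (cv v θ) x d) = cv v (fun x => fderiv ℝ θ x d) := by
  ext x
  rw [cv_eq, cv_eq]
  have h := hc.hasFDerivAt_convolution_right (ContinuousLinearMap.mul ℝ ℝ)
    hv.locallyIntegrable (hθ.of_le (by exact_mod_cast le_top)) x
  rw [h.fderiv, convolution_precompR_apply _ hv.locallyIntegrable (hc.fderiv ℝ)
    (hθ.continuous_fderiv (by simp))]

lemma compact_dd {θ : E2 → ℝ} (hc : HasCompactSupport θ) (d : E2) :
    HasCompactSupport fun x => fderiv ℝ θ x d := by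
  exact hc.fderiv_apply ℝ d

lemma lap_contDiff {θ : E2 → ℝ} (hθ : ContDiff ℝ (⊤ : ℕ∞) θ) : ContDiff ℝ (⊤ : ℕ∞) (lap θ) := by
  unfold lap
  exact ContDiff.sum fun i _ => contDiff_dd (contDiff_dd hθ _) _

lemma lap_compact {θ : E2 → ℝ} (hc : HasCompactSupport θ) : HasCompactSupport (lap θ) := by
  have : lap θ = fun x => fderiv ℝ (fun y => fderiv ℝ θ y (stdb2 0)) x (stdb2 0)
      + fderiv ℝ (fun y => fderiv ℝ θ y (stdb2 1)) x (stdb2 1) := by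
    ext x; simp [lap, Fin.sum_univ_two]
  rw [this]
  exact (compact_dd (compact_dd hc _) _).add (compact_dd (compact_dd hc _) _)

lemma cv_int {v θ : E2 → ℝ} (hv : Integrable v volume) (hθ : Continuous θ)
    (hc : HasCompactSupport θ) (x : E2) : Integrable (fun z => v z * θ (x - z)) volume := by
  obtain ⟨M, hM⟩ := hθ.bounded_above_of_compact_support hc
  refine (hv.mul_bdd (c := M) ?_ ?_)
  · exact (by fun_prop : Continuous fun z => θ (x - z)).aestronglyMeasurable
  · exact Filter.Eventually.of_forall fun z => hM _

lemma cv_lap {v θ : E2 → ℝ} (hv : Integrable v volume) (hθ : ContDiff ℝ (⊤ : ℕ∞) θ)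
    (hc : HasCompactSupport θ) : lap (cv v θ) = cv v (lap θ) := by
  ext x
  simp only [lap]
  simp_rw [cv_fderiv hv hθ hc]
  have e : ∀ i : Fin 2, fderiv ℝ (cv v fun y => fderiv ℝ θ y (stdb2 i)) x (stdb2 i)
      = cv v (fun x => fderiv ℝ (fun y => fderiv ℝ θ y (stdb2 i)) x (stdb2 i)) x := fun i =>
    congrFun (cv_fderiv hv (contDiff_dd hθ (stdb2 i)) (compact_dd hc (stdb2 i)) (stdb2 i)) x
  simp_rw [e]
  have hi : ∀ i : Fin 2, Integrable (fun z => v z *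
      fderiv ℝ (fun y => fderiv ℝ θ y (stdb2 i)) (x - z) (stdb2 i)) volume := fun i =>
    cv_int hv (cont_dd (contDiff_dd hθ _) (stdb2 i)) (compact_dd (compact_dd hc _) _) x
  rw [Fin.sum_univ_two]
  simp only [cv]
  rw [← integral_add (hi 0) (hi 1)]
  congr 1; ext z
  simp only [lap]
  rw [Fin.sum_univ_two]; ring

lemma fderiv_smul_sub (θ : E2 → ℝ) (hθ : Differentiable ℝ θ) (a : ℝ) (b x d : E2) :
    fderiv ℝ (fun y => θ (a • y + b)) x d = a * fderiv ℝ θ (a • x + b) d := by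
  have h1 : HasFDerivAt (fun y : E2 => a • y + b) (a • ContinuousLinearMap.id ℝ E2) x :=
    ((hasFDerivAt_id x).const_smul a).add_const b
  have h2 := (hθ (a • x + b)).hasFDerivAt.comp x h1
  have h3 : fderiv ℝ (fun y => θ (a • y + b)) x = _ := h2.fderiv
  rw [h3]
  simp

lemma lap_smul_sub {θ : E2 → ℝ} (hθ : ContDiff ℝ (⊤ : ℕ∞) θ) (a : ℝ) (b x : E2) :
    lap (fun y => θ (a • y + b)) x = a ^ 2 * lap θ (a • x + b) := by
  simp only [lap]
  rw [Finset.mul_sum]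
  refine Finset.sum_congr rfl fun i _ => ?_
  simp_rw [fderiv_smul_sub θ (hθ.differentiable (by simp))]
  have hd : Differentiable ℝ fun y => fderiv ℝ θ y (stdb2 i) :=
    (contDiff_dd hθ (stdb2 i)).differentiable (by simp)
  have h1 := fderiv_smul_sub (fun y => fderiv ℝ θ y (stdb2 i)) hd a b x (stdb2 i)
  have h2 : DifferentiableAt ℝ (fun y => fderiv ℝ θ (a • y + b) (stdb2 i)) x :=
    (hd.comp (by fun_prop : Differentiable ℝ fun y : E2 => a • y + b)) x
  rw [fderiv_const_mul h2]
  simp only [_root_.smul_apply, smul_eq_mul]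
  rw [h1]; ring

/-- if `Δ v = H` weakly on the whole plane then `Δ (v ⋆ θ) = H ⋆ θ` -/
lemma cv_lap_weak {v H θ : E2 → ℝ} (hv : Integrable v volume)
    (hw : ∀ φ : E2 → ℝ, ContDiff ℝ (⊤ : ℕ∞) φ → HasCompactSupport φ →
      ∫ z, v z * lap φ z = ∫ z, H z * φ z)
    (hθ : ContDiff ℝ (⊤ : ℕ∞) θ) (hc : HasCompactSupport θ) : lap (cv v θ) = cv H θ := by
  rw [cv_lap hv hθ hc]
  ext x
  have e1 : (fun z => θ (x - z)) = fun z => θ ((-1 : ℝ) • z + x) := by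
    ext z; congr 1; simp [sub_eq_neg_add]
  have h1 : ContDiff ℝ (⊤ : ℕ∞) fun z => θ (x - z) := hθ.comp (contDiff_const.sub contDiff_id)
  have h2 : HasCompactSupport fun z => θ (x - z) :=
    hc.comp_homeomorph (Homeomorph.subLeft x)
  have := hw _ h1 h2
  simp only [cv]
  rw [← this]
  congr 1; ext z
  rw [e1, lap_smul_sub hθ]
  congr 1
  simp only [neg_smul, one_smul, even_two, Even.neg_pow, one_pow, one_mul]
  congr 1; abel

lemma corr_fubini {u v θ : E2 → ℝ} (hu : MemLp u 2 volume) (hv : MemLp v 2 volume)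
    (hv1 : Integrable v volume) (hθ : Continuous θ) (hc : HasCompactSupport θ) {a : ℝ} (ha : 0 < a) :
    ∫ y, u y * cv v θ (a • y) = ∫ w, θ w * ∫ y, u y * v (a • y - w) ∧
    Integrable (fun w => θ w * ∫ y, u y * v (a • y - w)) volume := by
  have hθi : Integrable θ volume := hθ.integrable_of_hasCompactSupport hc
  have hq : Measure.QuasiMeasurePreserving (fun q : E2 × E2 => a • q.1 - q.2)
      (volume.prod volume) volume := by
    refine QuasiMeasurePreserving.prod_of_left (by fun_prop)
      (Filter.Eventually.of_forall fun w => ⟨by fun_prop, ?_⟩)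
    simp only
    rw [map_dil a ha w]
    exact Measure.smul_absolutelyContinuous
  have hm : AEStronglyMeasurable (fun q : E2 × E2 => θ q.2 * (u q.1 * v (a • q.1 - q.2)))
      (volume.prod volume) := by
    refine AEStronglyMeasurable.mul
      (by fun_prop : Continuous fun q : E2 × E2 => θ q.2).aestronglyMeasurable ?_
    exact (hu.1.comp_fst (ν := (volume : Measure E2))).mul (hv1.1.comp_quasiMeasurePreserving hq)
  have hInt : Integrable (fun q : E2 × E2 => θ q.2 * (u q.1 * v (a • q.1 - q.2)))
      (volume.prod volume) := by
    rw [integrable_prod_iff' hm]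
    refine ⟨Filter.Eventually.of_forall fun w => ?_, ?_⟩
    · exact (show Integrable (fun y => u y * v (a • y - w)) volume from
        hu.integrable_mul (dil_memLp hv a ha w)).const_mul (θ w)
    · set C : ℝ := (∫ y, (u y) ^ 2) + (a ^ 2)⁻¹ * ∫ y, (v y) ^ 2
      refine (hθi.norm.mul_const C).mono' hm.norm.prod_swap.integral_prod_right' ?_
      refine Filter.Eventually.of_forall fun w => ?_
      have hd := dil_memLp hv a ha w
      have hn : 0 ≤ ∫ y, ‖θ w * (u y * v (a • y - w))‖ := integral_nonneg fun y => norm_nonneg _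
      simp only
      rw [Real.norm_of_nonneg hn]
      simp_rw [norm_mul]
      rw [integral_const_mul]
      gcongr
      have e := dil_integral (fun y => (v y) ^ 2) a ha w
      rw [show C = ∫ y, ((u y) ^ 2 + (v (a • y - w)) ^ 2) by
        rw [integral_add hu.integrable_sq hd.integrable_sq, e]]
      refine integral_mono ?_ (hu.integrable_sq.add hd.integrable_sq) fun y => ?_
      · have := (hu.integrable_mul hd).norm
        simpa using this
      · simp only [Real.norm_eq_abs]
        nlinarith [sq_abs (u y), sq_abs (v (a • y - w)), sq_nonneg (|u y| - |v (a • y - w)|), sq_nonneg (|u y|), sq_nonneg (|v (a • y - w)|)]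
  constructor
  · have h1 : ∀ y, u y * cv v θ (a • y) = ∫ w, θ w * (u y * v (a • y - w)) := by
      intro y
      have : cv v θ (a • y) = ∫ w, θ w * v (a • y - w) := by
        rw [cv, ← integral_sub_left_eq_self (fun w => θ w * v (a • y - w)) volume (a • y)]
        congr 1; ext z; simp [mul_comm]
      rw [this, ← integral_const_mul]
      congr 1; ext w; ring
    simp_rw [h1]
    rw [integral_integral_swap hInt]
    simp_rw [integral_const_mul]
  · have := hInt.integral_prod_right
    simp only [integral_const_mul] at this
    exact this

/-- compactly supported harmonic functions vanish -/
lemma harm_zero {ψ : E2 → ℝ} (hψ : ContDiff ℝ (⊤ : ℕ∞) ψ) (hc : HasCompactSupport ψ)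
    (hl : lap ψ = 0) : ψ = 0 := by
  have hcont := hψ.continuous
  have hI : ∀ {a b : E2 → ℝ}, Continuous a → HasCompactSupport a → Continuous b →
      Integrable (fun x => a x * b x) volume := fun ha hca hb =>
    (ha.mul hb).integrable_of_hasCompactSupport hca.mul_right
  have key : ∀ i : Fin 2, ∫ x, ψ x * fderiv ℝ (fun y => fderiv ℝ ψ y (stdb2 i)) x (stdb2 i)
      = - ∫ x, (fderiv ℝ ψ x (stdb2 i)) * (fderiv ℝ ψ x (stdb2 i)) := by
    intro i
    have hc1 := cont_dd hψ (stdb2 i)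
    have hc2 := cont_dd (contDiff_dd hψ (stdb2 i)) (stdb2 i)
    refine integral_mul_fderiv_eq_neg_fderiv_mul_of_integrable
      (hI hc1 (compact_dd hc _) hc1) (hI hcont hc hc2) (hI hcont hc hc1) ?_ ?_
    · exact fun x _ => (hψ.differentiable (by simp)) x
    · exact fun x _ => ((contDiff_dd hψ (stdb2 i)).differentiable (by simp)) x
  have hsum : ∑ i : Fin 2, ∫ x, (fderiv ℝ ψ x (stdb2 i)) * (fderiv ℝ ψ x (stdb2 i)) = 0 := by
    have h0 : ∫ x, ψ x * lap ψ x = 0 := by simp [hl]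
    have h1 : ∀ x, ψ x * lap ψ x = ψ x * fderiv ℝ (fun y => fderiv ℝ ψ y (stdb2 0)) x (stdb2 0)
        + ψ x * fderiv ℝ (fun y => fderiv ℝ ψ y (stdb2 1)) x (stdb2 1) := by
      intro x; rw [lap, Fin.sum_univ_two]; ring
    simp_rw [h1] at h0
    rw [integral_add (hI hcont hc (cont_dd (contDiff_dd hψ (stdb2 0)) (stdb2 0)))
      (hI hcont hc (cont_dd (contDiff_dd hψ (stdb2 1)) (stdb2 1))), key, key] at h0
    rw [Fin.sum_univ_two]; linarith
  have hz : ∀ i : Fin 2, ∀ x, fderiv ℝ ψ x (stdb2 i) = 0 := by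
    intro i
    have hc1 := cont_dd hψ (stdb2 i)
    have h0 := (Finset.sum_eq_zero_iff_of_nonneg (fun i _ =>
      integral_nonneg fun x => mul_self_nonneg (fderiv ℝ ψ x (stdb2 i)))).1 hsum i (Finset.mem_univ i)
    have h1 := (integral_eq_zero_iff_of_nonneg (fun x => mul_self_nonneg (fderiv ℝ ψ x (stdb2 i)))
      (hI hc1 (compact_dd hc _) hc1)).1 h0
    have h2 := (hc1.mul hc1).ae_eq_iff_eq volume continuous_zero |>.1 h1
    intro x
    have := congrFun h2 x
    simpa using this
  have hf : ∀ x, fderiv ℝ ψ x = 0 := by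
    intro x
    ext v
    have hv : v = v 0 • stdb2 0 + v 1 • stdb2 1 := by
      ext i; fin_cases i <;> simp [stdb2]
    rw [hv, map_add, map_smul, map_smul, hz, hz]
    simp
  have hconst := is_const_of_fderiv_eq_zero (hψ.differentiable (by simp)) hf
  ext x
  by_contra hx
  have huniv : tsupport ψ = univ := by
    refine eq_univ_of_forall fun y => subset_tsupport _ ?_
    rw [Function.mem_support, hconst y x]; exact hx
  have : IsCompact (univ : Set E2) := huniv ▸ hc
  exact noncompact_univ E2 this

lemma ind_int (u f : E2 → ℝ) :
    ∫ x, (tri refTri).indicator u x * f x = ∫ x in tri refTri, u x * f x := by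
  rw [← integral_indicator (isOpen_tri refTri).measurableSet]
  congr 1; ext x
  by_cases hx : x ∈ tri refTri <;> simp [hx]

lemma ind_memLp {u : E2 → ℝ} (hu : L2on (tri refTri) u) :
    MemLp ((tri refTri).indicator u) 2 volume :=
  (memLp_indicator_iff_restrict (isOpen_tri refTri).measurableSet).2 hu

lemma ind_integrable {u : E2 → ℝ} (hu : L2on (tri refTri) u) :
    Integrable ((tri refTri).indicator u) volume :=
  (integrable_indicator_iff (isOpen_tri refTri).measurableSet).2 (hu.integrable one_le_two)

lemma ind_compact (u : E2 → ℝ) : HasCompactSupport ((tri refTri).indicator u) := by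
  refine HasCompactSupport.of_support_subset_isCompact (isCompact_hull refTri) ?_
  exact (support_indicator_subset).trans (tri_subset refTri)

/-- the mollified averages converge -/
lemma corr_avg {u v : E2 → ℝ} (hu : MemLp u 2 volume) (hu1 : Integrable u volume)
    (hv : MemLp v 2 volume) (hv1 : Integrable v volume) {ε : ℝ} (hε : 0 < ε) :
    ∃ η > 0, ∀ (a : ℝ) (c : E2) (χ : ContDiffBump c), 0 < a → |a - 1| < η → ‖c‖ + χ.rOut < η →
      |(∫ y, u y * cv v (χ.normed volume) (a • y)) - ∫ y, u y * v y| ≤ ε := by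
  obtain ⟨η, hη, H⟩ := corr_tendsto hu hu1 hv hε
  refine ⟨η, hη, fun a c χ ha ha1 hχ => ?_⟩
  set θ := χ.normed volume with hθ
  have hθc : Continuous θ := χ.contDiff_normed (n := 0) |>.continuous
  have hθs : HasCompactSupport θ := χ.hasCompactSupport_normed
  have hθi : Integrable θ volume := hθc.integrable_of_hasCompactSupport hθs
  obtain ⟨e, hi⟩ := corr_fubini hu hv hv1 hθc hθs ha
  have h1 : ∫ w, θ w * (∫ y, u y * v y) = ∫ y, u y * v y := by
    rw [integral_mul_const, hθ, χ.integral_normed, one_mul]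
  rw [e, ← h1, ← integral_sub hi (hθi.mul_const _), ← Real.norm_eq_abs]
  have h2 : ∫ w, θ w * ε = ε := by
    rw [integral_mul_const, hθ, χ.integral_normed, one_mul]
  rw [← h2]
  refine norm_integral_le_of_norm_le (hθi.mul_const _) (Filter.Eventually.of_forall fun w => ?_)
  rw [← mul_sub, norm_mul, Real.norm_of_nonneg (χ.nonneg_normed w)]
  by_cases hw : θ w = 0
  · rw [← hθ, hw]; simp
  · refine mul_le_mul_of_nonneg_left ?_ (χ.nonneg_normed w)
    have hw1 : w ∈ Metric.ball c χ.rOut := by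
      rw [← χ.support_normed_eq (μ := volume)]; exact hw
    have : ‖w‖ < η := by
      have h3 : ‖w - c‖ < χ.rOut := by simpa [dist_eq_norm] using hw1
      have h4 : ‖w‖ ≤ ‖c‖ + ‖w - c‖ := by
        simpa using norm_add_le c (w - c)
      linarith
    exact H a w ha1 this

lemma isPoly2_cont {m : ℤ} {ρ : E2 → ℝ} (h : IsPoly2DegLe m ρ) : Continuous ρ := by
  obtain ⟨Q, -, hQ⟩ := h
  have : ρ = fun x : E2 => MvPolynomial.eval (fun i => x i) Q := funext hQ
  rw [this]
  exact (MvPolynomial.continuous_eval Q).comp (by fun_prop)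

/-- admissible dilated mollification -/
lemma dil_support {u : E2 → ℝ} {r : ℝ} (hr : Metric.closedBall cref r ⊆ tri refTri) {s : ℝ}
    (hs0 : 0 < s) (hs1 : s < 1) (χ : ContDiffBump (((1 - s) / s) • cref))
    (hχ : χ.rOut = (1 - s) / s * r) :
    tsupport (fun y => cv ((tri refTri).indicator u) (χ.normed volume) (s⁻¹ • y)) ⊆ tri refTri := by
  set K : Set E2 := (fun q : E2 × E2 => s • q.1 + (1 - s) • q.2) ''
    (convexHull ℝ (range refTri) ×ˢ Metric.closedBall cref r) with hK
  have hKc : IsCompact K :=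
    ((isCompact_hull refTri).prod (isCompact_closedBall _ _)).image (by fun_prop)
  have hKT : K ⊆ tri refTri := by
    rintro _ ⟨⟨z, w⟩, ⟨hz, hw⟩, rfl⟩
    exact (convex_convexHull ℝ _).combo_closure_interior_mem_interior (subset_closure hz) (hr hw)
      hs0.le (by linarith) (by ring)
  refine (closure_minimal ?_ hKc.isClosed).trans hKT
  intro y hy
  rw [cv_eq] at hy
  have h1 := support_convolution_subset (ContinuousLinearMap.mul ℝ ℝ)
    (f := (tri refTri).indicator u) (g := χ.normed volume) (μ := volume)
    (show s⁻¹ • y ∈ Function.support _ from hy)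
  obtain ⟨z, hz, w, hw, e⟩ := h1
  rw [χ.support_normed_eq, hχ] at hw
  have hκ : 0 < (1 - s) / s := div_pos (by linarith) hs0
  refine ⟨(z, ((1 - s) / s)⁻¹ • w), ⟨tri_subset refTri (support_indicator_subset hz), ?_⟩, ?_⟩
  · rw [Metric.mem_closedBall, dist_eq_norm]
    have h2 : ((1 - s) / s)⁻¹ • w - cref = ((1 - s) / s)⁻¹ • (w - ((1 - s) / s) • cref) := by
      rw [smul_sub, smul_smul, inv_mul_cancel₀ hκ.ne', one_smul]
    rw [h2, norm_smul, norm_inv, Real.norm_of_nonneg hκ.le, inv_mul_le_iff₀ hκ]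
    have : ‖w - ((1 - s) / s) • cref‖ < (1 - s) / s * r := by simpa [dist_eq_norm] using hw
    exact this.le
  · have h3 : (1 - s) • ((1 - s) / s)⁻¹ • w = s • w := by
      rw [smul_smul]; congr 1
      have : 1 - s ≠ 0 := by linarith
      field_simp
    simp only
    rw [h3, ← smul_add, show z + w = s⁻¹ • y from e, smul_smul, mul_inv_cancel₀ hs0.ne', one_smul]

lemma vem_zero {m : ℤ} {ξ : E2 → ℝ} {G : Fin 2 → E2 → ℝ} {Hs : Fin 2 → Fin 2 → E2 → ℝ}
    (hξ : L2on (tri refTri) ξ) (hG : ∀ d, L2on (tri refTri) (G d))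
    (hHs : ∀ d d', L2on (tri refTri) (Hs d d'))
    (h0 : HasFaceTrace refTri ξ G (fun _ _ => 0))
    (h1 : ∀ d, HasFaceTrace refTri (G d) (Hs d) (fun _ _ => 0))
    (hb : BiharmPoly refTri m ξ)
    (hmom : ∀ q : E2 → ℝ, IsPoly2DegLe m q → ∫ x in tri refTri, ξ x * q x = 0) :
    ξ =ᵐ[volume.restrict (tri refTri)] 0 := by
  set H : E2 → ℝ := fun x => Hs 0 0 x + Hs 1 1 x with hHdef
  have hH : L2on (tri refTri) H := (hHs 0 0).add (hHs 1 1)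
  -- weak Laplacian
  have s0 : ∀ (φ : E2 → ℝ), ContDiff ℝ (⊤ : ℕ∞) φ → HasCompactSupport φ → ∀ d : Fin 2,
      ∫ x in tri refTri, ξ x * fderiv ℝ φ x (stdb2 d) = - ∫ x in tri refTri, G d x * φ x := by
    intro φ hφ hc d
    have := h0 φ hφ hc d
    rw [integral_add (L2on_int hξ (cont_dd hφ _)) (L2on_int (hG d) hφ.continuous)] at this
    simp at this; linarith
  have s1 : ∀ (φ : E2 → ℝ), ContDiff ℝ (⊤ : ℕ∞) φ → HasCompactSupport φ → ∀ d d' : Fin 2,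
      ∫ x in tri refTri, G d x * fderiv ℝ φ x (stdb2 d') = - ∫ x in tri refTri, Hs d d' x * φ x := by
    intro φ hφ hc d d'
    have := h1 d φ hφ hc d'
    rw [integral_add (L2on_int (hG d) (cont_dd hφ _)) (L2on_int (hHs d d') hφ.continuous)] at this
    simp at this; linarith
  have hT : ∀ φ : E2 → ℝ, ContDiff ℝ (⊤ : ℕ∞) φ → HasCompactSupport φ →
      ∫ z in tri refTri, ξ z * lap φ z = ∫ z in tri refTri, H z * φ z := by
    intro φ hφ hc
    have e : ∀ z, ξ z * lap φ z = ξ z * fderiv ℝ (fun y => fderiv ℝ φ y (stdb2 0)) z (stdb2 0)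
        + ξ z * fderiv ℝ (fun y => fderiv ℝ φ y (stdb2 1)) z (stdb2 1) := by
      intro z; rw [lap, Fin.sum_univ_two]; ring
    simp_rw [e]
    rw [integral_add (L2on_int hξ (cont_dd (contDiff_dd hφ _) _))
      (L2on_int hξ (cont_dd (contDiff_dd hφ _) _)),
      s0 _ (contDiff_dd hφ _) (compact_dd hc _), s0 _ (contDiff_dd hφ _) (compact_dd hc _),
      s1 _ hφ hc, s1 _ hφ hc, neg_neg, neg_neg,
      ← integral_add (L2on_int (hHs 0 0) hφ.continuous) (L2on_int (hHs 1 1) hφ.continuous)]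
    congr 1; ext z; rw [hHdef]; ring
  set ξt := (tri refTri).indicator ξ with hξt
  set Ht := (tri refTri).indicator H with hHt
  have hw : ∀ φ : E2 → ℝ, ContDiff ℝ (⊤ : ℕ∞) φ → HasCompactSupport φ →
      ∫ z, ξt z * lap φ z = ∫ z, Ht z * φ z := by
    intro φ hφ hc
    rw [hξt, hHt, ind_int, ind_int, hT φ hφ hc]
  obtain ⟨ρ, hρ, hbi⟩ := hb
  set ρt := (tri refTri).indicator ρ with hρt
  have hρ2 : L2on (tri refTri) ρ := cont_L2on refTri (isPoly2_cont hρ)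
  obtain ⟨r, hr0, hr⟩ := Metric.nhds_basis_closedBall.mem_iff.1
    ((isOpen_tri refTri).mem_nhds cref_mem)
  -- identity for the mollified dilations
  have hid : ∀ (s : ℝ), 0 < s → s < 1 → ∀ χ : ContDiffBump (((1 - s) / s) • cref),
      χ.rOut = (1 - s) / s * r →
      (s⁻¹) ^ 2 * ∫ y, Ht y * cv Ht (χ.normed volume) (s⁻¹ • y)
        = ∫ y, ρt y * cv ξt (χ.normed volume) (s⁻¹ • y) := by
    intro s hs0 hs1 χ hχ
    have hθ : ContDiff ℝ (⊤ : ℕ∞) (χ.normed volume) := χ.contDiff_normed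
    have hθc : HasCompactSupport (χ.normed volume) := χ.hasCompactSupport_normed
    have hψ := cv_contDiff (ind_integrable hξ) hθ hθc
    have hψc : HasCompactSupport (cv ξt (χ.normed volume)) := by
      rw [cv_eq]; exact (ind_compact ξ).convolution _ hθc
    have hφ : ContDiff ℝ (⊤ : ℕ∞) fun y => cv ξt (χ.normed volume) (s⁻¹ • y) :=
      hψ.comp (contDiff_id.const_smul _)
    have hφs := dil_support (u := ξ) hr hs0 hs1 χ hχ
    have hφc : HasCompactSupport fun y => cv ξt (χ.normed volume) (s⁻¹ • y) :=
      HasCompactSupport.intro (isCompact_hull refTri) fun y hy => by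
        by_contra hne
        exact hy (tri_subset refTri (hφs (subset_tsupport _ hne)))
    have hlap : lap (fun y => cv ξt (χ.normed volume) (s⁻¹ • y))
        = fun y => (s⁻¹) ^ 2 * cv Ht (χ.normed volume) (s⁻¹ • y) := by
      ext y
      have := lap_smul_sub hψ s⁻¹ 0 y
      simp only [add_zero] at this
      rw [this, cv_lap_weak (ind_integrable hξ) hw hθ hθc]
    have h2 := hbi _ hφ hφc hφs
    rw [hT _ (lap_contDiff hφ) (lap_compact hφc), hlap] at h2
    rw [hHt, hρt, ind_int, ind_int, ← h2, ← integral_const_mul]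
    congr 1; ext y; ring
  have hHH : ∫ y, Ht y * Ht y = ∫ y, ρt y * ξt y := by
    refine eq_of_forall_dist_le fun ε hε => ?_
    set A := ∫ y, Ht y * Ht y with hA
    set B := ∫ y, ρt y * ξt y with hB
    have hε' : 0 < ε / (4 * (|A| + ε + 10)) := by positivity
    obtain ⟨η1, hη1, K1⟩ := corr_avg (ind_memLp hH) (ind_integrable hH) (ind_memLp hH)
      (ind_integrable hH) (show 0 < ε / 10 by positivity)
    obtain ⟨η2, hη2, K2⟩ := corr_avg (ind_memLp hρ2) (ind_integrable hρ2) (ind_memLp hξ)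
      (ind_integrable hξ) (show 0 < ε / 10 by positivity)
    set κ : ℝ := min (min (η1 / (2 * (‖cref‖ + r + 1))) (η2 / (2 * (‖cref‖ + r + 1))))
      (min 1 (ε / (10 * (|A| + ε + 1)))) with hκ
    have hcr : 0 < ‖cref‖ + r + 1 := by positivity
    have hκ0 : 0 < κ := by positivity
    set s : ℝ := (1 + κ)⁻¹ with hs
    have hs0 : 0 < s := by positivity
    have hs1 : s < 1 := inv_lt_one_of_one_lt₀ (by linarith)
    have hsinv : s⁻¹ = 1 + κ := inv_inv _
    have hκs : (1 - s) / s = κ := by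
      rw [hs]; field_simp; ring
    let χ : ContDiffBump (((1 - s) / s) • cref) :=
      ⟨(1 - s) / s * r / 2, (1 - s) / s * r, by rw [hκs]; positivity, by
        rw [hκs]; have : 0 < κ * r := by positivity
        linarith⟩
    have hχ : χ.rOut = (1 - s) / s * r := rfl
    have hb : ∀ η : ℝ, 0 < η → κ ≤ η / (2 * (‖cref‖ + r + 1)) →
        |s⁻¹ - 1| < η ∧ ‖((1 - s) / s) • cref‖ + χ.rOut < η := by
      intro η hη hle
      rw [le_div_iff₀ (by positivity)] at hle
      rw [hχ, hκs, hsinv, norm_smul, Real.norm_of_nonneg hκ0.le, add_sub_cancel_left,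
        abs_of_pos hκ0]
      have : 0 ≤ κ * ‖cref‖ := by positivity
      have : 0 ≤ κ * r := by positivity
      constructor <;> nlinarith
    have b1 := hb η1 hη1 ((min_le_left _ _).trans (min_le_left _ _))
    have b2 := hb η2 hη2 ((min_le_left _ _).trans (min_le_right _ _))
    have k1 := K1 s⁻¹ _ χ (by positivity) b1.1 b1.2
    have k2 := K2 s⁻¹ _ χ (by positivity) b2.1 b2.2
    have k3 := hid s hs0 hs1 χ hχ
    rw [hsinv] at k1 k2 k3
    set a1 := ∫ y, Ht y * cv Ht (χ.normed volume) ((1 + κ) • y)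
    set a2 := ∫ y, ρt y * cv ξt (χ.normed volume) ((1 + κ) • y)
    have hκ1 : κ ≤ 1 := (min_le_right _ _).trans (min_le_left _ _)
    have hκ2 : κ * (10 * (|A| + ε + 1)) ≤ ε := by
      rw [← le_div_iff₀ (by positivity)]
      exact (min_le_right _ _).trans (min_le_right _ _)
    have hA1 : |a1| ≤ |A| + ε := by
      have : |a1| ≤ |A| + |a1 - A| := by simpa using abs_add_le A (a1 - A)
      linarith
    have k4 : |a1 - a2| ≤ 3 * κ * (|A| + ε) := by
      rw [← k3, show a1 - (1 + κ) ^ 2 * a1 = -(κ * (2 + κ)) * a1 by ring, abs_mul, abs_neg,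
        abs_of_pos (by positivity)]
      have : κ * (2 + κ) ≤ 3 * κ := by nlinarith
      gcongr
    have k5 : 3 * κ * (|A| + ε) ≤ ε / 2 := by nlinarith
    rw [Real.dist_eq]
    have : A - B = -(a1 - A) + (a1 - a2) + (a2 - B) := by ring
    rw [this]
    refine (abs_add_three _ _ _).trans ?_
    rw [abs_neg]
    linarith
  have hB0 : ∫ y, ρt y * ξt y = 0 := by
    have := hmom ρ hρ
    rw [hρt, ind_int]
    refine Eq.trans ?_ this
    refine setIntegral_congr_fun (isOpen_tri refTri).measurableSet fun x hx => ?_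
    rw [hξt]; simp [hx, mul_comm]
  rw [hB0] at hHH
  have hHt0 : Ht =ᵐ[volume] 0 := by
    have hi : Integrable (fun y => Ht y * Ht y) volume :=
      (ind_memLp hH).integrable_mul (ind_memLp hH)
    have := (integral_eq_zero_iff_of_nonneg (fun y => mul_self_nonneg (Ht y)) hi).1 hHH
    filter_upwards [this] with y hy
    simpa using hy
  refine ae_zero_of_test hξ fun φ hφ hc _ => ?_
  set θ : E2 → ℝ := fun z => φ (-z) with hθdef
  have hθ : ContDiff ℝ (⊤ : ℕ∞) θ := hφ.comp contDiff_neg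
  have hθc : HasCompactSupport θ := hc.comp_homeomorph (Homeomorph.neg E2)
  have hψ := cv_contDiff (ind_integrable hξ) hθ hθc
  have hψc : HasCompactSupport (cv ξt θ) := by
    rw [cv_eq]; exact (ind_compact ξ).convolution _ hθc
  have hl : lap (cv ξt θ) = 0 := by
    rw [cv_lap_weak (ind_integrable hξ) hw hθ hθc]
    ext x
    rw [cv, Pi.zero_apply, ← integral_zero E2 ℝ (μ := volume)]
    refine integral_congr_ae ?_
    filter_upwards [hHt0] with z hz
    simp [hz]
  have h2 := congrFun (harm_zero hψ hψc hl) 0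
  rw [cv] at h2
  simp only [hθdef, zero_sub, neg_neg, Pi.zero_apply] at h2
  rw [ind_int] at h2
  exact h2

/-! ### Part G: equivalence on the reference triangle -/

open Polynomial in
abbrev XA := (E2 → ℝ) × (Fin 3 → ℝ[X]) × (Fin 3 → Fin 2 → ℝ[X])

open Polynomial in
def XP (k : ℕ) (x : XA) : Prop :=
  (∀ j, x.2.1 j ∈ degreeLE ℝ k) ∧ (∀ j d, x.2.2 j d ∈ degreeLE ℝ k) ∧ L2on (tri refTri) x.1 ∧
  (∃ (G : Fin 2 → E2 → ℝ) (Hs : Fin 2 → Fin 2 → E2 → ℝ), (∀ d, L2on (tri refTri) (G d)) ∧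
    (∀ d d', L2on (tri refTri) (Hs d d')) ∧
    HasFaceTrace refTri x.1 G (fun j t => (x.2.1 j).eval t) ∧
    ∀ d, HasFaceTrace refTri (G d) (Hs d) (fun j t => (x.2.2 j d).eval t)) ∧
  BiharmPoly refTri ((k : ℤ) - 4) x.1

lemma isPoly2_comb {m : ℤ} {u v : E2 → ℝ} (a b : ℝ) (hu : IsPoly2DegLe m u)
    (hv : IsPoly2DegLe m v) : IsPoly2DegLe m (fun x => a * u x + b * v x) := by
  obtain ⟨Q, h1, h2⟩ := hu
  obtain ⟨R, h3, h4⟩ := hv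
  refine ⟨MvPolynomial.C a * Q + MvPolynomial.C b * R, fun d hd => ?_, fun x => ?_⟩
  · simp [h1 d hd, h3 d hd]
  · simp [h2, h4]

lemma L2on_comb {p : Fin 3 → E2} {u v : E2 → ℝ} (a b : ℝ) (hu : L2on (tri p) u)
    (hv : L2on (tri p) v) : L2on (tri p) (fun x => a * u x + b * v x) :=
  (MemLp.const_mul hu a).add (MemLp.const_mul hv b)

lemma biharm_comb {p : Fin 3 → E2} {m : ℤ} {u v : E2 → ℝ} (a b : ℝ) (hu : L2on (tri p) u)
    (hv : L2on (tri p) v) (h1 : BiharmPoly p m u) (h2 : BiharmPoly p m v) :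
    BiharmPoly p m (fun x => a * u x + b * v x) := by
  obtain ⟨ρ, hρ, h1⟩ := h1
  obtain ⟨σ, hσ, h2⟩ := h2
  refine ⟨_, isPoly2_comb a b hρ hσ, fun φ hφ hc hs => ?_⟩
  have hl : Continuous (lap (lap φ)) := (lap_contDiff (lap_contDiff hφ)).continuous
  have e1 : ∀ x, (a * u x + b * v x) * lap (lap φ) x
      = a * (u x * lap (lap φ) x) + b * (v x * lap (lap φ) x) := fun x => by ring
  have e2 : ∀ x, (a * ρ x + b * σ x) * φ x = a * (ρ x * φ x) + b * (σ x * φ x) := fun x => by ring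
  simp only [e1, e2]
  rw [integral_add ((L2on_int hu hl).const_mul a) ((L2on_int hv hl).const_mul b),
    integral_add ((L2on_int (cont_L2on p (isPoly2_cont hρ)) hφ.continuous).const_mul a)
      ((L2on_int (cont_L2on p (isPoly2_cont hσ)) hφ.continuous).const_mul b)]
  simp only [integral_const_mul]
  rw [h1 φ hφ hc hs, h2 φ hφ hc hs]

lemma XP_comb {k : ℕ} {x y : XA} (a b : ℝ) (hx : XP k x) (hy : XP k y) : XP k (a • x + b • y) := by
  obtain ⟨x1, x2, x3, ⟨G, Hs, g1, g2, g3, g4⟩, x5⟩ := hx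
  obtain ⟨y1, y2, y3, ⟨G', Hs', g1', g2', g3', g4'⟩, y5⟩ := hy
  refine ⟨fun j => ?_, fun j d => ?_, L2on_comb a b x3 y3, ⟨fun d x => a * G d x + b * G' d x,
    fun d d' x => a * Hs d d' x + b * Hs' d d' x, fun d => L2on_comb a b (g1 d) (g1' d),
    fun d d' => L2on_comb a b (g2 d d') (g2' d d'), ?_, fun d => ?_⟩, biharm_comb a b x3 y3 x5 y5⟩
  · exact Submodule.add_mem _ (Submodule.smul_mem _ _ (x1 j)) (Submodule.smul_mem _ _ (y1 j))
  · exact Submodule.add_mem _ (Submodule.smul_mem _ _ (x2 j d)) (Submodule.smul_mem _ _ (y2 j d))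
  · convert faceTrace_comb a b x3 g1 y3 g1' (fun j => by fun_prop) (fun j => by fun_prop) g3 g3'
      using 1
    all_goals first | rfl | (ext j t; simp)
  · convert faceTrace_comb a b (g1 d) (g2 d) (g1' d) (g2' d) (fun j => by fun_prop)
      (fun j => by fun_prop) (g4 d) (g4' d) using 1
    ext j t; simp

lemma XP_zero (k : ℕ) : XP k 0 := by
  refine ⟨fun j => Submodule.zero_mem _, fun j d => Submodule.zero_mem _, MemLp.zero,
    ⟨fun _ _ => 0, fun _ _ _ => 0, fun d => MemLp.zero, fun d d' => MemLp.zero, ?_, fun d => ?_⟩,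
    fun _ => 0, ⟨0, by simp, by simp⟩, ?_⟩
  · intro φ _ _ d; simp
  · intro φ _ _ d; simp
  · intro φ _ _ _; simp

def XS (k : ℕ) : Submodule ℝ XA where
  carrier := {x | XP k x}
  zero_mem' := XP_zero k
  add_mem' {x y} hx hy := by simpa using XP_comb 1 1 hx hy
  smul_mem' c x hx := by simpa using XP_comb c 0 hx (XP_zero k)

lemma XS_mem {k : ℕ} (x : XS k) : XP k x.1 := x.2

def XtoLp (k : ℕ) : XS k →ₗ[ℝ] Lp ℝ 2 (volume.restrict (tri refTri)) where
  toFun x := MemLp.toLp x.1.1 (XS_mem x).2.2.1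
  map_add' x y := rfl
  map_smul' c x := rfl

def Xmom (k : ℕ) : XS k →ₗ[ℝ] (Fin k × Fin k → ℝ) where
  toFun x ab := if (ab.1 : ℕ) + ab.2 + 4 ≤ k then
    ∫ y in tri refTri, x.1.1 y * (y 0 ^ (ab.1 : ℕ) * y 1 ^ (ab.2 : ℕ)) else 0
  map_add' x y := by
    ext ab
    simp only [Pi.add_apply]
    split_ifs with h
    · rw [← integral_add (L2on_int (XS_mem x).2.2.1 (by fun_prop))
        (L2on_int (XS_mem y).2.2.1 (by fun_prop))]
      congr 1; ext z; simp; ring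
    · simp
  map_smul' c x := by
    ext ab
    simp only [Pi.smul_apply, RingHom.id_apply, smul_eq_mul]
    split_ifs with h
    · rw [← integral_const_mul]
      congr 1; ext z; simp; ring
    · simp

def XcP (k : ℕ) : XS k →ₗ[ℝ] (Fin 3 × Fin (k + 1) → ℝ) where
  toFun x jn := (x.1.2.1 jn.1).coeff jn.2
  map_add' x y := by ext; simp
  map_smul' c x := by ext; simp

def XcG (k : ℕ) : XS k →ₗ[ℝ] ((Fin 3 × Fin 2) × Fin (k + 1) → ℝ) where
  toFun x jn := (x.1.2.2 jn.1.1 jn.1.2).coeff jn.2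
  map_add' x y := by ext; simp
  map_smul' c x := by ext; simp

lemma vem_coeff_zero {k : ℕ} {P : Polynomial ℝ} (h : P ∈ Polynomial.degreeLE ℝ k)
    (h0 : ∀ n : Fin (k + 1), P.coeff n = 0) : P = 0 := by
  ext n
  by_cases hn : n < k + 1
  · simpa using h0 ⟨n, hn⟩
  · rw [Polynomial.coeff_eq_zero_of_natDegree_lt]; · simp
    have := vem_natDegree_le h; omega

/-- vanishing degrees of freedom give a vanishing function -/
lemma X_ker (k : ℕ) (x : XS k) (h : sumL (Xmom k) (sumL (XcP k) (XcG k)) x = 0) :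
    XtoLp k x = 0 := by
  have h1 : ∀ ab, Xmom k x ab = 0 := fun ab => congrFun h (Sum.inl ab)
  have h2 : ∀ a, XcP k x a = 0 := fun a => congrFun h (Sum.inr (Sum.inl a))
  have h3 : ∀ a, XcG k x a = 0 := fun a => congrFun h (Sum.inr (Sum.inr a))
  obtain ⟨x1, x2, x3, ⟨G, Hs, g1, g2, g3, g4⟩, x5⟩ := XS_mem x
  have hP : ∀ j, x.1.2.1 j = 0 := fun j => vem_coeff_zero (x1 j) fun n => h2 (j, n)
  have hG : ∀ j d, x.1.2.2 j d = 0 := fun j d => vem_coeff_zero (x2 j d) fun n => h3 ((j, d), n)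
  simp only [hP, Polynomial.eval_zero] at g3
  simp only [hG, Polynomial.eval_zero] at g4
  have := vem_zero x3 g1 g2 g3 g4 x5 (by
    rintro q ⟨Q, hQ, hq⟩
    have e : ∀ y : E2, x.1.1 y * q y
        = ∑ d ∈ Q.support, Q.coeff d * (x.1.1 y * (y 0 ^ d 0 * y 1 ^ d 1)) := by
      intro y
      rw [hq, MvPolynomial.eval_eq', Finset.mul_sum]
      refine Finset.sum_congr rfl fun d _ => ?_
      rw [Fin.prod_univ_two]; ring
    simp only [e]
    rw [integral_finsetSum _ fun d _ => (L2on_int x3 (by fun_prop)).const_mul _]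
    refine Finset.sum_eq_zero fun d hd => ?_
    rw [integral_const_mul]
    have hle : d 0 + d 1 + 4 ≤ k := by
      by_contra hcon
      exact MvPolynomial.mem_support_iff.1 hd (hQ d (by push_cast; omega))
    have := h1 (⟨d 0, by omega⟩, ⟨d 1, by omega⟩)
    simp only [Xmom, LinearMap.coe_mk, AddHom.coe_mk, hle, if_true] at this
    rw [this, mul_zero])
  exact (MemLp.toLp_eq_toLp_iff x3 MemLp.zero).2 this

lemma X_ker' (k : ℕ) (x : XS k) (h : XtoLp k x = 0) :
    sumL (XcP k) (XcG k) x = 0 := by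
  obtain ⟨x1, x2, x3, ⟨G, Hs, g1, g2, g3, g4⟩, x5⟩ := XS_mem x
  have h0 : x.1.1 =ᵐ[volume.restrict (tri refTri)] 0 :=
    (MemLp.toLp_eq_toLp_iff x3 MemLp.zero).1 h
  obtain ⟨a1, a2⟩ := trace_unique _ h0 g1 g3
  have a3 : ∀ d j, x.1.2.2 j d = 0 := fun d =>
    (trace_unique (fun j => x.1.2.2 j d) (a1 d) (g2 d) (g4 d)).2
  ext (a | a)
  · simp [sumL, XcP, a2]
  · simp [sumL, XcG, a3]

lemma XtoLp_norm (k : ℕ) (x : XS k) : ‖XtoLp k x‖ ^ 2 = ∫ y in tri refTri, (x.1.1 y) ^ 2 := by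
  rw [← real_inner_self_eq_norm_sq, L2.inner_def]
  refine integral_congr_ae ?_
  filter_upwards [MemLp.coeFn_toLp (XS_mem x).2.2.1] with y hy
  have : (XtoLp k x : E2 → ℝ) y = x.1.1 y := hy
  rw [this]; simp [sq]

lemma vem_ref1 (k : ℕ) : ∃ C : ℝ, 0 < C ∧ ∀ x : XA, XP k x →
    ∫ y in tri refTri, (x.1 y) ^ 2 ≤ C * ((∑ ab : Fin k × Fin k,
      if (ab.1 : ℕ) + ab.2 + 4 ≤ k then
        (∫ y in tri refTri, x.1 y * (y 0 ^ (ab.1 : ℕ) * y 1 ^ (ab.2 : ℕ))) ^ 2 else 0) +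
      ((∑ j, nP k (x.2.1 j)) + ∑ j, ∑ d, nP k (x.2.2 j d))) := by
  obtain ⟨C, hC, h⟩ := vem_bound_of_ker _ _ (X_ker k)
  refine ⟨C ^ 2, by positivity, fun x hx => ?_⟩
  have h1 := h ⟨x, hx⟩
  have h2 := XtoLp_norm k ⟨x, hx⟩
  rw [← h2]
  have h3 := pow_le_pow_left₀ (norm_nonneg _) h1 2
  rw [mul_pow] at h3
  refine h3.trans (mul_le_mul_of_nonneg_left ((vem_norm_sq_le _).trans (le_of_eq ?_))
    (by positivity))
  simp only [Fintype.sum_sum_type, sumL, LinearMap.coe_mk, AddHom.coe_mk, Sum.elim_inl,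
    Sum.elim_inr]
  congr 1
  · refine Finset.sum_congr rfl fun ab _ => ?_
    simp only [Xmom, LinearMap.coe_mk, AddHom.coe_mk]
    split_ifs <;> simp
  · simp only [XcP, XcG, LinearMap.coe_mk, AddHom.coe_mk, Fintype.sum_prod_type, nP]

lemma vem_ref2 (k : ℕ) : ∃ C : ℝ, 0 < C ∧ ∀ x : XA, XP k x →
    (∑ j, nP k (x.2.1 j)) + ∑ j, ∑ d, nP k (x.2.2 j d)
      ≤ C * ∫ y in tri refTri, (x.1 y) ^ 2 := by
  haveI := vem_range_fd_of_ker _ _ (X_ker k)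
  obtain ⟨C, hC, h⟩ := vem_bound_of_ker _ _ (X_ker' k)
  refine ⟨(Fintype.card (Fin 3 × Fin (k + 1) ⊕ (Fin 3 × Fin 2) × Fin (k + 1)) + 1) * C ^ 2,
    by positivity, fun x hx => ?_⟩
  have h1 := h ⟨x, hx⟩
  have h2 := XtoLp_norm k ⟨x, hx⟩
  rw [← h2]
  have h3 := pow_le_pow_left₀ (norm_nonneg _) h1 2
  rw [mul_pow] at h3
  have h4 : (∑ j, nP k (x.2.1 j)) + ∑ j, ∑ d, nP k (x.2.2 j d)
      = ∑ i, (sumL (XcP k) (XcG k) ⟨x, hx⟩ i) ^ 2 := by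
    simp only [Fintype.sum_sum_type, sumL, LinearMap.coe_mk, AddHom.coe_mk, Sum.elim_inl,
      Sum.elim_inr, XcP, XcG, Fintype.sum_prod_type, nP]
  rw [h4]
  calc _ ≤ ∑ i : Fin 3 × Fin (k + 1) ⊕ (Fin 3 × Fin 2) × Fin (k + 1),
        C ^ 2 * ‖XtoLp k ⟨x, hx⟩‖ ^ 2 :=
        Finset.sum_le_sum fun i _ => (vem_sq_le_norm_sq _ i).trans h3
    _ ≤ _ := by
        rw [Finset.sum_const, nsmul_eq_mul, Finset.card_univ, mul_assoc]
        refine mul_le_mul_of_nonneg_right (by linarith) (by positivity)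

/-! ### Part H: transformation to the reference triangle -/

lemma norv_zero (p : Fin 3 → E2) (j : Fin 3) : norv p j 0 = tangv p j 1 := by simp [norv]
lemma norv_one (p : Fin 3 → E2) (j : Fin 3) : norv p j 1 = -tangv p j 0 := by simp [norv]

lemma tangv_unit {p : Fin 3 → E2} {j : Fin 3} (h : 0 < elen p j) :
    tangv p j 0 ^ 2 + tangv p j 1 ^ 2 = 1 := by
  rw [← norm_sq_E2, tangv, norm_smul, norm_inv]
  rw [elen] at h ⊢
  rw [norm_norm, inv_mul_cancel₀ h.ne', one_pow]

lemma frame_sq {p : Fin 3 → E2} {j : Fin 3} (h : 0 < elen p j) (v : E2) :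
    ⟪v, tangv p j⟫ ^ 2 + ⟪v, norv p j⟫ ^ 2 = ‖v‖ ^ 2 := by
  rw [inner_E2, inner_E2, norm_sq_E2, norv_zero, norv_one]
  linear_combination (v 0 ^ 2 + v 1 ^ 2) * tangv_unit h

open Polynomial in
def GamH (p : Fin 3 → E2) (P R : Fin 3 → ℝ[X]) (j : Fin 3) (d : Fin 2) : ℝ[X] :=
  ((elen p j)⁻¹ * ⟪linp p (stdb2 d), tangv p j⟫) • derivative (P j)
    + ⟪linp p (stdb2 d), norv p j⟫ • R j

lemma faceTrace_congr {p : Fin 3 → E2} {u : E2 → ℝ} {Du : Fin 2 → E2 → ℝ} {b b' : Fin 3 → ℝ → ℝ}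
    (h : ∀ j, ∀ t ∈ Ioo (0:ℝ) 1, b j t = b' j t) (H : HasFaceTrace p u Du b) :
    HasFaceTrace p u Du b' := by
  intro φ hφ hc d
  rw [H φ hφ hc d]
  refine Finset.sum_congr rfl fun j _ => ?_
  congr 1
  exact setIntegral_congr_fun measurableSet_Ioo fun t ht => by simp only [h j t ht]

open Polynomial in
lemma derivWithin_poly {u : ℝ → ℝ} {P : ℝ[X]} (h : ∀ t, u t = P.eval t) (t : ℝ)
    (ht : t ∈ Icc (0:ℝ) 1) : derivWithin u (Icc 0 1) t = (derivative P).eval t := by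
  have : u = fun t => P.eval t := funext h
  rw [this]
  exact (P.hasDerivAt t).hasDerivWithinAt.derivWithin (uniqueDiffOn_Icc zero_lt_one t ht)

open Polynomial in
lemma vem_pull {p : Fin 3 → E2} {k : ℕ} (hk : 3 ≤ k) (h : 0 < detp p) {ξ : E2 → ℝ}
    {f g : Fin 3 → ℝ → ℝ}
    (hm : MemVEMgenT p k ξ f g) {P R : Fin 3 → ℝ[X]} (hP : ∀ j, P j ∈ degreeLE ℝ k)
    (hR : ∀ j, R j ∈ degreeLE ℝ ((k - 1 : ℕ) : WithBot ℕ))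
    (hf : ∀ j t, f j t = (P j).eval t) (hg : ∀ j t, g j t = (R j).eval t) :
    XP k (fun x => ξ (affMap p x), P, GamH p P R) := by
  obtain ⟨⟨fr, gr, -, -, -, -, -, -, hB⟩, -, -, G, Hs, ⟨m1, m2, m3⟩, t1, t2⟩ := hm
  have hG := fun d => (m2 d).1
  have hH := fun d d' => (m3 d d').1
  have t1' : HasFaceTrace p ξ G (fun j t => (P j).eval t) :=
    faceTrace_congr (fun j t _ => hf j t) t1
  have t2' : ∀ d, HasFaceTrace p (G d) (Hs d) (fun j t =>
      (((elen p j)⁻¹ * tangv p j d) • derivative (P j) + norv p j d • R j).eval t) := by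
    intro d
    refine faceTrace_congr (fun j t ht => ?_) (t2 d)
    simp only [gfield, derivWithin_poly (hf j) t ⟨ht.1.le, ht.2.le⟩, hg]
    simp; ring
  refine ⟨hP, fun j d => ?_, L2on_affMap p h m1,
    ⟨fun d x => ∑ i, (linp p (stdb2 d)) i * G i (affMap p x),
     fun d d' x => (linp p (stdb2 d)) 0 * (∑ i, (linp p (stdb2 d')) i * Hs 0 i (affMap p x))
       + (linp p (stdb2 d)) 1 * (∑ i, (linp p (stdb2 d')) i * Hs 1 i (affMap p x)),
     fun d => ?_, fun d d' => ?_, faceTrace_pull h m1 hG t1', fun d => ?_⟩, hB⟩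
  · refine Submodule.add_mem _ (Submodule.smul_mem _ _ (vem_deriv_mem k _ (hP j)))
      (Submodule.smul_mem _ _ (degreeLE_mono ?_ (hR j)))
    exact_mod_cast Nat.sub_le k 1
  · simp only [Fin.sum_univ_two]
    exact L2on_comb _ _ (L2on_affMap p h (hG 0)) (L2on_affMap p h (hG 1))
  · simp only [Fin.sum_univ_two]
    exact L2on_comb _ _
      (L2on_comb _ _ (L2on_affMap p h (hH 0 0)) (L2on_affMap p h (hH 0 1)))
      (L2on_comb _ _ (L2on_affMap p h (hH 1 0)) (L2on_affMap p h (hH 1 1)))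
  · have hs : ∀ i d', L2on (tri refTri)
        (fun x => ∑ i', (linp p (stdb2 d')) i' * Hs i i' (affMap p x)) := by
      intro i d'
      simp only [Fin.sum_univ_two]
      exact L2on_comb _ _ (L2on_affMap p h (hH i 0)) (L2on_affMap p h (hH i 1))
    have := faceTrace_comb ((linp p (stdb2 d)) 0) ((linp p (stdb2 d)) 1)
      (L2on_affMap p h (hG 0)) (hs 0) (L2on_affMap p h (hG 1)) (hs 1)
      (fun j => by fun_prop) (fun j => by fun_prop)
      (faceTrace_pull h (hG 0) (hH 0) (t2' 0)) (faceTrace_pull h (hG 1) (hH 1) (t2' 1))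
    have e : (fun x => ∑ i, (linp p (stdb2 d)) i * G i (affMap p x)) =
        fun x => (linp p (stdb2 d)) 0 * G 0 (affMap p x) + (linp p (stdb2 d)) 1 * G 1 (affMap p x) := by
      ext x; rw [Fin.sum_univ_two]
    beta_reduce
    rw [e]
    refine faceTrace_congr (fun j t _ => ?_) this
    simp only [GamH, eval_add, eval_smul, smul_eq_mul, inner_E2]
    ring

lemma linp_le (p : Fin 3 → E2) (h : 0 < detp p) (d : Fin 2) :
    ‖linp p (stdb2 d)‖ ≤ Metric.diam (tri p) := by
  rw [diam_tri p h]
  have : linp p (stdb2 d) = p d.succ - p 0 := by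
    fin_cases d <;> simp [linp, stdb2]
  rw [this, ← dist_eq_norm]
  exact Metric.dist_le_diam_of_mem (finite_range p).isBounded (mem_range_self _) (mem_range_self _)

lemma crs_lin (p : Fin 3 → E2) : crs (linp p (stdb2 0)) (linp p (stdb2 1)) = detp p := by
  simp [linp, stdb2, crs, detp]

open Polynomial in
lemma nP_smul (k : ℕ) (a : ℝ) (P : ℝ[X]) : nP k (a • P) = a ^ 2 * nP k P := by
  simp only [nP, coeff_smul, smul_eq_mul, mul_pow, Finset.mul_sum]

open Polynomial in
lemma GamH_le {p : Fin 3 → E2} {k : ℕ} (h : 0 < detp p) {P R : Fin 3 → ℝ[X]}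
    (hP : ∀ j, P j ∈ degreeLE ℝ k) (j : Fin 3) (d : Fin 2) {m : ℝ} (hm : 0 < m)
    (hd : 0 < Metric.diam (tri p)) (hl : m * Metric.diam (tri p) ≤ elen p j) :
    nP k (GamH p P R j d) ≤ 2 * k ^ 2 * (m⁻¹) ^ 2 * nP k (P j)
      + 2 * Metric.diam (tri p) ^ 2 * nP k (R j) := by
  set H := Metric.diam (tri p)
  have hl0 : 0 < elen p j := lt_of_lt_of_le (by positivity) hl
  have h1 := frame_sq hl0 (linp p (stdb2 d))
  have h2 := pow_le_pow_left₀ (norm_nonneg _) (linp_le p h d) 2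
  have h3 : ⟪linp p (stdb2 d), tangv p j⟫ ^ 2 ≤ H ^ 2 := by
    nlinarith [sq_nonneg ⟪linp p (stdb2 d), norv p j⟫]
  have h4 : ⟪linp p (stdb2 d), norv p j⟫ ^ 2 ≤ H ^ 2 := by
    nlinarith [sq_nonneg ⟪linp p (stdb2 d), tangv p j⟫]
  refine (vem_nP_comb k _ _ _ _).trans (add_le_add ?_ ?_)
  · have h5 : ((elen p j)⁻¹ * ⟪linp p (stdb2 d), tangv p j⟫) ^ 2 ≤ (m⁻¹) ^ 2 := by
      have : (elen p j)⁻¹ ≤ (m * H)⁻¹ := inv_anti₀ (by positivity) hl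
      rw [mul_pow]
      calc _ ≤ ((m * H)⁻¹) ^ 2 * H ^ 2 := by gcongr
        _ = (m⁻¹) ^ 2 := by field_simp
    have h6 := vem_nP_deriv k _ (hP j)
    have := nP_nonneg k (derivative (P j))
    calc _ ≤ 2 * (m⁻¹) ^ 2 * (k ^ 2 * nP k (P j)) := by gcongr
      _ = _ := by ring
  · have := nP_nonneg k (R j)
    gcongr

open Polynomial in
lemma R_le {p : Fin 3 → E2} {k : ℕ} (h : 0 < detp p) {P R : Fin 3 → ℝ[X]}
    (j : Fin 3) {m : ℝ} (hm : 0 < m)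
    (hd : 0 < Metric.diam (tri p)) (hl : m * Metric.diam (tri p) ≤ elen p j)
    (hD : m * Metric.diam (tri p) ^ 2 ≤ detp p) :
    m ^ 2 * Metric.diam (tri p) ^ 2 * nP k (R j) ≤
      2 * (nP k (GamH p P R j 0) + nP k (GamH p P R j 1)) := by
  set H := Metric.diam (tri p)
  have hl0 : 0 < elen p j := lt_of_lt_of_le (by positivity) hl
  set a := linp p (stdb2 0) with ha
  set b := linp p (stdb2 1) with hb
  have hab : crs a b = detp p := crs_lin p
  have hu := tangv_unit hl0
  have key : detp p • R j = crs (norv p j) b • GamH p P R j 0 + crs a (norv p j) • GamH p P R j 1 := by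
    simp only [GamH, ← ha, ← hb, smul_add, smul_smul]
    have e1 : crs (norv p j) b * ((elen p j)⁻¹ * ⟪a, tangv p j⟫)
        + crs a (norv p j) * ((elen p j)⁻¹ * ⟪b, tangv p j⟫) = 0 := by
      rw [inner_E2, inner_E2, crs, crs, norv_zero, norv_one]; ring
    have e2 : crs (norv p j) b * ⟪a, norv p j⟫ + crs a (norv p j) * ⟪b, norv p j⟫ = detp p := by
      rw [← hab, inner_E2, inner_E2, crs, crs, crs, norv_zero, norv_one]
      linear_combination (a 0 * b 1 - a 1 * b 0) * hu
    rw [← e2, add_smul]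
    have e3 := congrArg (fun c => c • derivative (P j)) e1
    simp only [add_smul, zero_smul] at e3
    rw [add_add_add_comm, e3, zero_add]
  have hn : ‖norv p j‖ ^ 2 = 1 := by
    rw [norm_sq_E2, norv_zero, norv_one]; linarith
  have c1 : crs (norv p j) b ^ 2 ≤ H ^ 2 := by
    have := crs_sq (norv p j) b
    have h2 := pow_le_pow_left₀ (norm_nonneg _) (linp_le p h 1) 2
    rw [hn] at this
    nlinarith [sq_nonneg ⟪norv p j, b⟫]
  have c2 : crs a (norv p j) ^ 2 ≤ H ^ 2 := by
    have := crs_sq a (norv p j)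
    have h2 := pow_le_pow_left₀ (norm_nonneg _) (linp_le p h 0) 2
    rw [hn] at this
    nlinarith [sq_nonneg ⟪a, norv p j⟫]
  have h5 := vem_nP_comb k (GamH p P R j 0) (GamH p P R j 1) (crs (norv p j) b) (crs a (norv p j))
  rw [← key, nP_smul] at h5
  have n0 := nP_nonneg k (GamH p P R j 0)
  have n1 := nP_nonneg k (GamH p P R j 1)
  have n2 := nP_nonneg k (R j)
  have h6 : (m * H ^ 2) ^ 2 * nP k (R j) ≤ 2 * H ^ 2 * nP k (GamH p P R j 0)
      + 2 * H ^ 2 * nP k (GamH p P R j 1) := by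
    calc _ ≤ detp p ^ 2 * nP k (R j) := by gcongr
      _ ≤ _ := h5
      _ ≤ _ := by gcongr
  have h7 : H ^ 2 * (m ^ 2 * H ^ 2 * nP k (R j)) ≤
      H ^ 2 * (2 * (nP k (GamH p P R j 0) + nP k (GamH p P R j 1))) := by
    linarith
  exact le_of_mul_le_mul_left h7 (by positivity)

/-! ### Part I: moments -/

lemma push_mono {p : Fin 3 → E2} (h : 0 < detp p) (a b : ℕ) (m : ℤ) (hab : (a : ℤ) + b ≤ m) :
    ∃ q : E2 → ℝ, IsPoly2DegLe m q ∧ ∀ x : E2, q (affMap p x) = x 0 ^ a * x 1 ^ b := by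
  let L : ℝ → ℝ → ℝ → MvPolynomial (Fin 2) ℝ := fun c0 c1 c =>
    MvPolynomial.C c0 * MvPolynomial.X 0 + MvPolynomial.C c1 * MvPolynomial.X 1 + MvPolynomial.C c
  have hL : ∀ c0 c1 c, (L c0 c1 c).totalDegree ≤ 1 := by
    intro c0 c1 c
    refine (MvPolynomial.totalDegree_add _ _).trans (max_le ((MvPolynomial.totalDegree_add _ _).trans
      (max_le ?_ ?_)) (by simp))
    · exact (MvPolynomial.totalDegree_mul _ _).trans (by simp)
    · exact (MvPolynomial.totalDegree_mul _ _).trans (by simp)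
  set u := p 1 - p 0 with hu
  set v := p 2 - p 0 with hv
  set D := detp p with hD
  have hDe : D = u 0 * v 1 - u 1 * v 0 := rfl
  let L0 := L (D⁻¹ * v 1) (-(D⁻¹ * v 0)) (D⁻¹ * (p 0 1 * v 0 - p 0 0 * v 1))
  let L1 := L (-(D⁻¹ * u 1)) (D⁻¹ * u 0) (D⁻¹ * (p 0 0 * u 1 - p 0 1 * u 0))
  refine ⟨fun x => MvPolynomial.eval (fun i => x i) (L0 ^ a * L1 ^ b),
    ⟨L0 ^ a * L1 ^ b, fun d hd => ?_, fun x => rfl⟩, fun x => ?_⟩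
  · apply MvPolynomial.coeff_eq_zero_of_totalDegree_lt
    have h1 : (L0 ^ a * L1 ^ b).totalDegree ≤ a + b := by
      refine (MvPolynomial.totalDegree_mul _ _).trans (add_le_add ?_ ?_)
      · exact (MvPolynomial.totalDegree_pow _ _).trans
          ((Nat.mul_le_mul_left a (hL _ _ _)).trans (by simp))
      · exact (MvPolynomial.totalDegree_pow _ _).trans
          ((Nat.mul_le_mul_left b (hL _ _ _)).trans (by simp))
    have h2 : ∑ i ∈ d.support, d i = d 0 + d 1 := by
      rw [← Fin.sum_univ_two (fun i => d i)]
      exact Finset.sum_subset (Finset.subset_univ _) fun i _ hi => by simpa using hi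
    rw [h2]
    push_cast at hd
    omega
  · have e0 : affMap p x 0 = p 0 0 + x 0 * u 0 + x 1 * v 0 := by simp [affMap, hu, hv]
    have e1 : affMap p x 1 = p 0 1 + x 0 * u 1 + x 1 * v 1 := by simp [affMap, hu, hv]
    have hi : D⁻¹ * D = 1 := inv_mul_cancel₀ h.ne'
    simp only [map_mul, map_pow]
    congr 2
    · simp only [L0, L, map_add, map_mul, MvPolynomial.eval_C, MvPolynomial.eval_X, e0, e1]
      rw [hDe] at hi ⊢
      linear_combination x 0 * hi
    · simp only [L1, L, map_add, map_mul, MvPolynomial.eval_C, MvPolynomial.eval_X, e0, e1]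
      rw [hDe] at hi ⊢
      linear_combination x 1 * hi

lemma affMap_cont (p : Fin 3 → E2) : Continuous (affMap p) := by
  unfold affMap; fun_prop

def Kmom (k : ℕ) : ℝ := ∑ ab : Fin k × Fin k,
  ∫ y in tri refTri, (y 0 ^ (ab.1 : ℕ) * y 1 ^ (ab.2 : ℕ)) ^ 2

lemma Kmom_nonneg (k : ℕ) : 0 ≤ Kmom k :=
  Finset.sum_nonneg fun _ _ => integral_nonneg fun _ => sq_nonneg _

lemma mom_le {p : Fin 3 → E2} (h : 0 < detp p) (k : ℕ) {ξ qT : E2 → ℝ} (hξ : L2on (tri p) ξ)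
    (h1 : IsPoly2DegLe ((k : ℤ) - 4) qT)
    (h2 : ∀ q : E2 → ℝ, IsPoly2DegLe ((k : ℤ) - 4) q → ∫ x in tri p, (ξ x - qT x) * q x = 0) :
    detp p * (∑ ab : Fin k × Fin k, if (ab.1 : ℕ) + ab.2 + 4 ≤ k then
        (∫ y in tri refTri, ξ (affMap p y) * (y 0 ^ (ab.1 : ℕ) * y 1 ^ (ab.2 : ℕ))) ^ 2 else 0)
      ≤ Kmom k * ∫ x in tri p, (qT x) ^ 2 := by
  rw [integral_affMap p h, mul_left_comm, Kmom]
  refine mul_le_mul_of_nonneg_left ?_ h.le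
  rw [Finset.sum_mul]
  refine Finset.sum_le_sum fun ab _ => ?_
  have hq : Continuous fun x => qT (affMap p x) := (isPoly2_cont h1).comp (affMap_cont p)
  have hmc : Continuous fun y : E2 => y 0 ^ (ab.1 : ℕ) * y 1 ^ (ab.2 : ℕ) := by fun_prop
  split_ifs with hab
  · obtain ⟨q, q1, q2⟩ := push_mono h ab.1 ab.2 ((k : ℤ) - 4) (by omega)
    have e := h2 q q1
    rw [integral_affMap p h] at e
    have e := (mul_eq_zero.1 e).resolve_left h.ne'
    simp only [q2, sub_mul] at e
    rw [integral_sub (L2on_int (L2on_affMap p h hξ) hmc)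
      (L2on_int (cont_L2on refTri hq) hmc), sub_eq_zero] at e
    rw [e, mul_comm]
    exact vem_cs (cont_L2on refTri hq) (cont_L2on refTri hmc)
  · exact mul_nonneg (integral_nonneg fun _ => sq_nonneg _) (integral_nonneg fun _ => sq_nonneg _)

lemma proj2_le {p : Fin 3 → E2} {m : ℤ} {ξ qT : E2 → ℝ} (hξ : L2on (tri p) ξ)
    (h1 : IsPoly2DegLe m qT)
    (h2 : ∀ q : E2 → ℝ, IsPoly2DegLe m q → ∫ x in tri p, (ξ x - qT x) * q x = 0) :
    ∫ x in tri p, (qT x) ^ 2 ≤ ∫ x in tri p, (ξ x) ^ 2 := by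
  have hq := cont_L2on p (isPoly2_cont h1)
  have e := h2 qT h1
  have h3 : 0 ≤ ∫ x in tri p, (ξ x - qT x) ^ 2 := integral_nonneg fun _ => sq_nonneg _
  have e1 : ∀ x, (ξ x - qT x) ^ 2 = (ξ x ^ 2 - qT x ^ 2) - 2 * ((ξ x - qT x) * qT x) :=
    fun x => by ring
  simp only [e1] at h3
  have i1 : Integrable (fun x => ξ x ^ 2) (volume.restrict (tri p)) := MemLp.integrable_sq hξ
  have i2 : Integrable (fun x => qT x ^ 2) (volume.restrict (tri p)) := MemLp.integrable_sq hq
  have i3 : Integrable (fun x => 2 * ((ξ x - qT x) * qT x)) (volume.restrict (tri p)) :=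
    (L2on_int (MemLp.sub hξ hq) (isPoly2_cont h1)).const_mul 2
  have i4 : Integrable (fun x => ξ x ^ 2 - qT x ^ 2) (volume.restrict (tri p)) := i1.sub i2
  rw [integral_sub i4 i3, integral_sub i1 i2, integral_const_mul, e] at h3
  linarith

theorem vem_L2_norm_equivalence (k : ℕ) (hk : 3 ≤ k) (δ : ℝ) (hδ : 0 < δ) :
    ∃ c C : ℝ, 0 < c ∧ 0 < C ∧
      ∀ (p : Fin 3 → E2), ccw p → MinAngleLB δ p →
      ∀ (ξ : E2 → ℝ) (f g : Fin 3 → ℝ → ℝ) (w : Fin 3 → E2)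
        (qT : E2 → ℝ) (qe re : Fin 3 → ℝ → ℝ),
        MemVEMgenT p k ξ f g →
        -- `w` are the (unique) vertex gradient vectors of the compatibility conditions
        (∀ i j : Fin 3, j ≠ i →
          derivWithin (f j) (Icc 0 1) (tau i j) = elen p j * ⟪w i, tangv p j⟫ ∧
          g j (tau i j) = ⟪w i, norv p j⟫) →
        -- `qT = Q_{T,k-4} ξ`
        (IsPoly2DegLe ((k : ℤ) - 4) qT ∧ ∀ q : E2 → ℝ, IsPoly2DegLe ((k : ℤ) - 4) q →
          ∫ x in tri p, (ξ x - qT x) * q x = 0) →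
        -- `qe i = Q_{e_i,k-4} ξ|_{e_i}` (in the parametrization of the edge)
        (∀ i, IsPolyDegLe ((k : ℤ) - 4) (qe i) ∧ ∀ q : ℝ → ℝ, IsPolyDegLe ((k : ℤ) - 4) q →
          ∫ t in Ioo (0:ℝ) 1, (f i t - qe i t) * q t = 0) →
        -- `re i = Q_{e_i,k-3} (∂ξ/∂n)|_{e_i}`
        (∀ i, IsPolyDegLe ((k : ℤ) - 3) (re i) ∧ ∀ q : ℝ → ℝ, IsPolyDegLe ((k : ℤ) - 3) q →
          ∫ t in Ioo (0:ℝ) 1, (g i t - re i t) * q t = 0) →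
        c * ∫ x in tri p, (ξ x) ^ 2 ≤
            (∫ x in tri p, (qT x) ^ 2) +
            (∑ i : Fin 3,
              (Metric.diam (tri p) * (elen p i * ∫ t in Ioo (0:ℝ) 1, (qe i t) ^ 2) +
               Metric.diam (tri p) ^ 3 * (elen p i * ∫ t in Ioo (0:ℝ) 1, (re i t) ^ 2))) +
            (∑ i : Fin 3,
              (Metric.diam (tri p) ^ 2 * (f (i + 1) 1) ^ 2 +
               Metric.diam (tri p) ^ 4 * ‖w i‖ ^ 2)) ∧
          (∫ x in tri p, (qT x) ^ 2) +
            (∑ i : Fin 3,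
              (Metric.diam (tri p) * (elen p i * ∫ t in Ioo (0:ℝ) 1, (qe i t) ^ 2) +
               Metric.diam (tri p) ^ 3 * (elen p i * ∫ t in Ioo (0:ℝ) 1, (re i t) ^ 2))) +
            (∑ i : Fin 3,
              (Metric.diam (tri p) ^ 2 * (f (i + 1) 1) ^ 2 +
               Metric.diam (tri p) ^ 4 * ‖w i‖ ^ 2))
            ≤ C * ∫ x in tri p, (ξ x) ^ 2 := by
  obtain ⟨m, hm, hm1, hshape⟩ := vem_shape δ hδ
  obtain ⟨C1, hC1, hR1⟩ := vem_ref1 k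
  obtain ⟨C4, hC4, hR2⟩ := vem_ref2 k
  obtain ⟨C2, hC2, hpF⟩ := vem_polyF k hk
  obtain ⟨C3, hC3, hpG⟩ := vem_polyG k hk
  have hK := Kmom_nonneg k
  obtain ⟨μ, hμ⟩ : ∃ μ, μ = m⁻¹ := ⟨_, rfl⟩
  have hμ1 : 1 ≤ μ := by rw [hμ]; exact (one_le_inv₀ hm).2 hm1
  have hμm : μ * m = 1 := by rw [hμ]; exact inv_mul_cancel₀ hm.ne'
  obtain ⟨A, hA⟩ : ∃ A, A = C2 * (5 * μ) := ⟨_, rfl⟩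
  obtain ⟨B, hB⟩ : ∃ B, B = 2 * k ^ 2 * μ ^ 2 * A + 2 * (C3 * (3 * μ)) := ⟨_, rfl⟩
  obtain ⟨a, ha⟩ : ∃ a, a = (k + 1) * C4 * μ := ⟨_, rfl⟩
  obtain ⟨b, hb⟩ : ∃ b, b = 2 * μ ^ 3 * C4 := ⟨_, rfl⟩
  have hA0 : 0 < A := by rw [hA]; positivity
  have hB0 : 0 < B := by rw [hB]; positivity
  have ha0 : 0 < a := by rw [ha]; positivity
  have hb0 : 0 < b := by rw [hb]; positivity
  refine ⟨(C1 * (Kmom k + 3 * A + 6 * B))⁻¹,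
    1 + 3 * (a + (k + 1) * b) + 3 * (a + (μ ^ 2 * k ^ 2 * a + (k + 1) * b)),
    by positivity, by positivity, ?_⟩
  intro p hp hang ξ f g w qT qe re hV hw ⟨hq1, hq2⟩ hqe hre
  have hD0 : 0 < detp p := hp
  obtain ⟨hlen, hDl, hDu, hH0⟩ := hshape p hD0 hang
  have hlen' := elen_le_diam p hD0
  obtain ⟨H, hH⟩ : ∃ H, H = Metric.diam (tri p) := ⟨_, rfl⟩
  have hGam := fun (P R : Fin 3 → Polynomial ℝ) (hP : ∀ j, P j ∈ Polynomial.degreeLE ℝ k) j d =>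
    GamH_le (R := R) hD0 hP j d hm hH0 (hlen j)
  have hRle := fun (P R : Fin 3 → Polynomial ℝ) j =>
    R_le (k := k) (P := P) (R := R) hD0 j hm hH0 (hlen j) hDl
  simp only [← hμ, ← hH] at hGam
  simp only [← hH] at hlen hDl hDu hH0 hlen' hRle ⊢
  clear hH
  -- polynomial representatives
  choose P hP hPf using fun j => vem_isPoly_iff (hV.2.1 j).1
  have hg' : ∀ j, IsPolyDegLe (((k - 1 : ℕ) : ℕ) : ℤ) (g j) := fun j => by
    have := (hV.2.1 j).2
    rwa [Nat.cast_sub (by omega : 1 ≤ k), Nat.cast_one]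
  choose R hR hRg using fun j => vem_isPoly_iff (hg' j)
  have hXP := vem_pull hk hD0 hV hP hR hPf hRg
  have hξ : L2on (tri p) ξ := by
    obtain ⟨-, -, -, G, Hs, ⟨m1, -⟩, -⟩ := hV
    exact m1
  have r1 := hR1 _ hXP
  have r2 := hR2 _ hXP
  have r3 := mom_le hD0 k hξ hq1 hq2
  have r4 := proj2_le hξ hq1 hq2
  have r5 := integral_affMap p hD0 (fun x => (ξ x) ^ 2)
  simp only at r1 r2 r5
  have hl0 : ∀ j, 0 < elen p j := fun j => lt_of_lt_of_le (by positivity) (hlen j)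
  have hR' : ∀ j, R j ∈ Polynomial.degreeLE ℝ k := fun j =>
    Polynomial.degreeLE_mono (by exact_mod_cast Nat.sub_le k 1) (hR j)
  have pF := fun j => hpF (P j) (hP j) (qe j) (hqe j).1
    (fun r hr => by simpa only [hPf] using (hqe j).2 r hr)
  have pG := fun j => hpG (R j) (hR j) (re j) (hre j).1
    (fun r hr => by simpa only [hRg] using (hre j).2 r hr)
  -- vertex data
  have hw1 : ∀ i j : Fin 3, j ≠ i → ((P j).derivative.eval (tau i j)) ^ 2
      = elen p j ^ 2 * ⟪w i, tangv p j⟫ ^ 2 := by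
    intro i j hij
    have := (hw i j hij).1
    rw [derivWithin_poly (hPf j) _ (by unfold tau; split_ifs <;> simp)] at this
    rw [this, mul_pow]
  have hw2 : ∀ i j : Fin 3, j ≠ i → ((R j).eval (tau i j)) ^ 2 = ⟪w i, norv p j⟫ ^ 2 := by
    intro i j hij
    have := (hw i j hij).2
    rw [hRg] at this
    rw [this]
  have hfr : ∀ i j : Fin 3, j ≠ i → ⟪w i, tangv p j⟫ ^ 2 + ⟪w i, norv p j⟫ ^ 2 = ‖w i‖ ^ 2 :=
    fun i j _ => frame_sq (hl0 j) (w i)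
  have ne1 : ∀ j : Fin 3, j ≠ j + 1 := by decide
  have ne2 : ∀ j : Fin 3, j ≠ j + 2 := by decide
  have t1 : ∀ j : Fin 3, tau (j + 1) j = 0 := fun j => by simp [tau]
  have t2 : ∀ j : Fin 3, tau (j + 2) j = 1 := fun j => by fin_cases j <;> simp [tau]
  have v0 : ∀ j, (P j).eval 0 = f (j + 1 + 1) 1 := fun j => by
    have := hV.2.2.1.1 (j + 1) j (j + 1 + 1) (ne1 j) (ne1 (j + 1)).symm
    rw [t1, hPf j] at this
    rw [this]
    congr 1
    fin_cases j <;> simp [tau]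
  have v1 : ∀ j, (P j).eval 1 = f (j + 2 + 1) 1 := fun j => by
    rw [show j + 2 + 1 = j from by fin_cases j <;> rfl, hPf]
  -- names for the quantities
  obtain ⟨N, hN⟩ : ∃ N, N = ∫ y in tri refTri, (ξ (affMap p y)) ^ 2 := ⟨_, rfl⟩
  obtain ⟨I, hI⟩ : ∃ I, I = ∫ x in tri p, (ξ x) ^ 2 := ⟨_, rfl⟩
  obtain ⟨Q, hQ⟩ : ∃ Q, Q = ∫ x in tri p, (qT x) ^ 2 := ⟨_, rfl⟩
  obtain ⟨F, hF⟩ : ∃ F : Fin 3 → ℝ, ∀ i, F i = ∫ t in Ioo (0:ℝ) 1, (qe i t) ^ 2 := ⟨_, fun _ => rfl⟩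
  obtain ⟨E, hE⟩ : ∃ E : Fin 3 → ℝ, ∀ i, E i = ∫ t in Ioo (0:ℝ) 1, (re i t) ^ 2 := ⟨_, fun _ => rfl⟩
  have F0 : ∀ i, 0 ≤ F i := fun i => by rw [hF]; exact integral_nonneg fun _ => sq_nonneg _
  have E0 : ∀ i, 0 ≤ E i := fun i => by rw [hE]; exact integral_nonneg fun _ => sq_nonneg _
  have Q0 : 0 ≤ Q := by rw [hQ]; exact integral_nonneg fun _ => sq_nonneg _
  have N0 : 0 ≤ N := by rw [hN]; exact integral_nonneg fun _ => sq_nonneg _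
  have I0 : 0 ≤ I := by rw [hI]; exact integral_nonneg fun _ => sq_nonneg _
  have hF' : ∀ i, F i ≤ (k + 1) * nP k (P i) := fun i => by
    rw [hF]
    refine (vem_proj_le (f i) (qe i) _ (vem_isPoly_cont (hV.2.1 i).1) (hqe i).1 (hqe i).2).trans ?_
    simp only [hPf]
    exact vem_int_sq_le k _ (hP i)
  have hE' : ∀ i, E i ≤ (k + 1) * nP k (R i) := fun i => by
    rw [hE]
    refine (vem_proj_le (g i) (re i) _ (vem_isPoly_cont (hV.2.1 i).2) (hre i).1 (hre i).2).trans ?_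
    simp only [hRg]
    exact vem_int_sq_le k _ (hR' i)
  have hv' : ∀ i, (f (i + 1) 1) ^ 2 ≤ (k + 1) * nP k (P (i + 1)) := fun i => by
    rw [hPf]; exact vem_eval_sq_le k _ (hP _) 1 (by simp)
  have hW' : ∀ i, elen p (i + 1) ^ 2 * ‖w i‖ ^ 2 ≤ (k + 1) * (k ^ 2 * nP k (P (i + 1)))
      + elen p (i + 1) ^ 2 * ((k + 1) * nP k (R (i + 1))) := fun i => by
    have hij : i + 1 ≠ i := (ne1 i).symm
    have ht : tau i (i + 1) ∈ Icc (0:ℝ) 1 := by unfold tau; split_ifs <;> simp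
    rw [← hfr i (i + 1) hij, mul_add, ← hw1 i (i + 1) hij, ← hw2 i (i + 1) hij]
    have e1 := vem_eval_sq_le k _ (vem_deriv_mem k _ (hP (i + 1))) _ ht
    have e2 := vem_eval_sq_le k _ (hR' (i + 1)) _ ht
    have e3 := vem_nP_deriv k _ (hP (i + 1))
    refine add_le_add (e1.trans ?_) ?_ <;> gcongr
  have nPn := nP_nonneg k
  simp only [← hF, ← hE, ← hQ, ← hI, ← hN] at r1 r2 r3 r4 r5 pF pG ⊢
  clear hF hE hQ hI hN hR1 hR2 hpF hpG hshape hV hw hqe hre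
  -- total of the degrees of freedom
  obtain ⟨Y1, hY1⟩ : ∃ Y1, Y1 = ∑ i : Fin 3, (H * (elen p i * F i) + H ^ 3 * (elen p i * E i)) :=
    ⟨_, rfl⟩
  obtain ⟨Y2, hY2⟩ : ∃ Y2, Y2 = ∑ i : Fin 3, (H ^ 2 * (f (i + 1) 1) ^ 2 + H ^ 4 * ‖w i‖ ^ 2) :=
    ⟨_, rfl⟩
  rw [← hY1, ← hY2]
  have y1 : ∀ i, 0 ≤ H * (elen p i * F i) := fun i => by
    have := hl0 i; have := F0 i; positivity
  have y2 : ∀ i, 0 ≤ H ^ 3 * (elen p i * E i) := fun i => by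
    have := hl0 i; have := E0 i; positivity
  have Y1i : ∀ i, H * (elen p i * F i) + H ^ 3 * (elen p i * E i) ≤ Y1 := fun i => by
    rw [hY1]
    exact Finset.single_le_sum (f := fun i => H * (elen p i * F i) + H ^ 3 * (elen p i * E i))
      (fun i _ => add_nonneg (y1 i) (y2 i)) (Finset.mem_univ i)
  have Y2i : ∀ i, H ^ 2 * (f (i + 1) 1) ^ 2 + H ^ 4 * ‖w i‖ ^ 2 ≤ Y2 := fun i => by
    rw [hY2]
    exact Finset.single_le_sum (f := fun i => H ^ 2 * (f (i + 1) 1) ^ 2 + H ^ 4 * ‖w i‖ ^ 2)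
      (fun i _ => by positivity) (Finset.mem_univ i)
  have Y10 : 0 ≤ Y1 := le_trans (add_nonneg (y1 0) (y2 0)) (Y1i 0)
  have Y20 : 0 ≤ Y2 := le_trans (by positivity) (Y2i 0)
  obtain ⟨Y, hY⟩ : ∃ Y, Y = Q + Y1 + Y2 := ⟨_, rfl⟩
  rw [← hY]
  have hHl : ∀ i, H ≤ μ * elen p i := fun i => by
    calc H = μ * (m * H) := by rw [← mul_assoc, hμm, one_mul]
      _ ≤ _ := by gcongr; exact hlen i
  constructor
  · have zF : ∀ i, H ^ 2 * F i ≤ μ * Y := fun i => by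
      calc H ^ 2 * F i = H * (H * F i) := by ring
        _ ≤ H * ((μ * elen p i) * F i) := mul_le_mul_of_nonneg_left (mul_le_mul_of_nonneg_right (hHl i) (F0 i)) hH0.le
        _ = μ * (H * (elen p i * F i)) := by ring
        _ ≤ μ * Y := by gcongr; linarith [Y1i i, y2 i]
    have zE : ∀ i, H ^ 4 * E i ≤ μ * Y := fun i => by
      calc H ^ 4 * E i = H ^ 3 * (H * E i) := by ring
        _ ≤ H ^ 3 * ((μ * elen p i) * E i) := mul_le_mul_of_nonneg_left (mul_le_mul_of_nonneg_right (hHl i) (E0 i)) (by positivity)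
        _ = μ * (H ^ 3 * (elen p i * E i)) := by ring
        _ ≤ μ * Y := by gcongr; linarith [Y1i i, y1 i]
    have Y0 : 0 ≤ Y := by linarith
    have hYμ : Y ≤ μ * Y := by nlinarith
    have zv : ∀ i, H ^ 2 * (f (i + 1) 1) ^ 2 ≤ μ * Y := fun i => by
      have := Y2i i
      have : 0 ≤ H ^ 4 * ‖w i‖ ^ 2 := by positivity
      linarith
    have zw : ∀ i, H ^ 4 * ‖w i‖ ^ 2 ≤ μ * Y := fun i => by
      have := Y2i i
      have : 0 ≤ H ^ 2 * (f (i + 1) 1) ^ 2 := by positivity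
      linarith
    have zd : ∀ i j, j ≠ i → H ^ 2 * ((P j).derivative.eval (tau i j)) ^ 2 ≤ μ * Y := by
      intro i j hij
      rw [hw1 i j hij]
      refine le_trans ?_ (zw i)
      have h1 : ⟪w i, tangv p j⟫ ^ 2 ≤ ‖w i‖ ^ 2 := by
        rw [← hfr i j hij]; linarith [sq_nonneg ⟪w i, norv p j⟫]
      have h2 := hl0 j
      calc _ ≤ H ^ 2 * (H ^ 2 * ‖w i‖ ^ 2) := by gcongr; exact hlen' j
        _ = _ := by ring
    have zn : ∀ i j, j ≠ i → H ^ 4 * ((R j).eval (tau i j)) ^ 2 ≤ μ * Y := by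
      intro i j hij
      rw [hw2 i j hij]
      refine le_trans ?_ (zw i)
      have h1 : ⟪w i, norv p j⟫ ^ 2 ≤ ‖w i‖ ^ 2 := by
        rw [← hfr i j hij]; linarith [sq_nonneg ⟪w i, tangv p j⟫]
      gcongr
    have sF : ∀ j, H ^ 2 * nP k (P j) ≤ A * Y := fun j => by
      have d0 := zd (j + 1) j (ne1 j)
      have d1 := zd (j + 2) j (ne2 j)
      rw [t1] at d0
      rw [t2] at d1
      have d2 := zv (j + 1)
      have d3 := zv (j + 2)
      rw [← v0] at d2
      rw [← v1] at d3
      calc H ^ 2 * nP k (P j) ≤ H ^ 2 * _ := mul_le_mul_of_nonneg_left (pF j) (by positivity)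
        _ = C2 * (H ^ 2 * F j + (H ^ 2 * (P j).eval 0 ^ 2 + H ^ 2 * (P j).eval 1 ^ 2
            + H ^ 2 * (P j).derivative.eval 0 ^ 2 + H ^ 2 * (P j).derivative.eval 1 ^ 2)) := by ring
        _ ≤ C2 * (μ * Y + (μ * Y + μ * Y + μ * Y + μ * Y)) := mul_le_mul_of_nonneg_left (by linarith [zF j]) hC2.le
        _ = A * Y := by rw [hA]; ring
    have sG : ∀ j, H ^ 4 * nP k (R j) ≤ C3 * (3 * μ) * Y := fun j => by
      have d0 := zn (j + 1) j (ne1 j)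
      have d1 := zn (j + 2) j (ne2 j)
      rw [t1] at d0
      rw [t2] at d1
      calc H ^ 4 * nP k (R j) ≤ H ^ 4 * _ := mul_le_mul_of_nonneg_left (pG j) (by positivity)
        _ = C3 * (H ^ 4 * E j + (H ^ 4 * (R j).eval 0 ^ 2 + H ^ 4 * (R j).eval 1 ^ 2)) := by ring
        _ ≤ C3 * (μ * Y + (μ * Y + μ * Y)) := mul_le_mul_of_nonneg_left (by linarith [zE j]) hC3.le
        _ = _ := by ring
    have sH : ∀ j d, H ^ 2 * nP k (GamH p P R j d) ≤ B * Y := fun j d => by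
      calc _ ≤ H ^ 2 * _ := mul_le_mul_of_nonneg_left (hGam P R hP j d) (by positivity)
        _ = 2 * k ^ 2 * μ ^ 2 * (H ^ 2 * nP k (P j)) + 2 * (H ^ 4 * nP k (R j)) := by ring
        _ ≤ 2 * k ^ 2 * μ ^ 2 * (A * Y) + 2 * (C3 * (3 * μ) * Y) :=
            add_le_add (mul_le_mul_of_nonneg_left (sF j) (by positivity))
              (mul_le_mul_of_nonneg_left (sG j) (by norm_num))
        _ = B * Y := by rw [hB]; ring
    rw [inv_mul_le_iff₀ (by positivity)]
    obtain ⟨M, hM⟩ : ∃ M, M = (∑ ab : Fin k × Fin k, if (ab.1 : ℕ) + ab.2 + 4 ≤ k then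
        (∫ y in tri refTri, ξ (affMap p y) * (y 0 ^ (ab.1 : ℕ) * y 1 ^ (ab.2 : ℕ))) ^ 2 else 0) :=
      ⟨_, rfl⟩
    rw [← hM] at r1 r3
    have u1 : detp p * M ≤ Kmom k * Y := r3.trans (by gcongr; linarith)
    have u2 : detp p * ∑ j, nP k (P j) ≤ 3 * A * Y := by
      rw [Finset.mul_sum]
      calc _ ≤ ∑ j : Fin 3, A * Y := Finset.sum_le_sum fun j _ =>
            (mul_le_mul_of_nonneg_right hDu (nPn _)).trans (sF j)
        _ = _ := by simp; ring
    have u3 : detp p * ∑ j, ∑ d, nP k (GamH p P R j d) ≤ 6 * B * Y := by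
      rw [Finset.mul_sum]
      simp only [Finset.mul_sum]
      calc _ ≤ ∑ j : Fin 3, ∑ d : Fin 2, B * Y := Finset.sum_le_sum fun j _ =>
            Finset.sum_le_sum fun d _ => (mul_le_mul_of_nonneg_right hDu (nPn _)).trans (sH j d)
        _ = _ := by simp; ring
    calc I = detp p * N := r5
      _ ≤ detp p * _ := mul_le_mul_of_nonneg_left r1 hD0.le
      _ = C1 * (detp p * M + (detp p * ∑ j, nP k (P j)
          + detp p * ∑ j, ∑ d, nP k (GamH p P R j d))) := by ring
      _ ≤ C1 * (Kmom k * Y + (3 * A * Y + 6 * B * Y)) := by gcongr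
      _ = _ := by ring
  · have hHN : H ^ 2 * N ≤ μ * I := by
      calc H ^ 2 * N = μ * ((m * H ^ 2) * N) := by
            rw [mul_assoc m, ← mul_assoc μ, hμm, one_mul]
        _ ≤ μ * (detp p * N) := by gcongr
        _ = μ * I := by rw [r5]
    have sP0 : 0 ≤ ∑ j, nP k (P j) := Finset.sum_nonneg fun j _ => nPn _
    have sG0 : 0 ≤ ∑ j, ∑ d, nP k (GamH p P R j d) :=
      Finset.sum_nonneg fun j _ => Finset.sum_nonneg fun d _ => nPn _
    have hPN : ∀ j, nP k (P j) ≤ C4 * N := fun j => by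
      have := Finset.single_le_sum (f := fun j => nP k (P j)) (fun j _ => nPn _) (Finset.mem_univ j)
      linarith
    have hGN : ∀ j, nP k (GamH p P R j 0) + nP k (GamH p P R j 1) ≤ C4 * N := fun j => by
      have := Finset.single_le_sum (f := fun j => ∑ d, nP k (GamH p P R j d))
        (fun j _ => Finset.sum_nonneg fun d _ => nPn _) (Finset.mem_univ j)
      simp only [Fin.sum_univ_two] at this sG0 r2
      linarith
    have xP : ∀ j, (k + 1) * (H ^ 2 * nP k (P j)) ≤ a * I := fun j => by
      calc _ ≤ (k + 1) * (H ^ 2 * (C4 * N)) := by gcongr; exact hPN j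
        _ = (k + 1) * C4 * (H ^ 2 * N) := by ring
        _ ≤ (k + 1) * C4 * (μ * I) := by gcongr
        _ = a * I := by rw [ha]; ring
    have xR : ∀ j, H ^ 4 * nP k (R j) ≤ b * I := fun j => by
      have e1 : m ^ 2 * H ^ 2 * nP k (R j) ≤ 2 * (C4 * N) :=
        (hRle P R j).trans (by linarith [hGN j])
      calc H ^ 4 * nP k (R j) = (μ * m) ^ 2 * (H ^ 4 * nP k (R j)) := by rw [hμm]; ring
        _ = μ ^ 2 * H ^ 2 * (m ^ 2 * H ^ 2 * nP k (R j)) := by ring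
        _ ≤ μ ^ 2 * H ^ 2 * (2 * (C4 * N)) := by gcongr
        _ = 2 * μ ^ 2 * C4 * (H ^ 2 * N) := by ring
        _ ≤ 2 * μ ^ 2 * C4 * (μ * I) := by gcongr
        _ = b * I := by rw [hb]; ring
    have xF : ∀ i, H * (elen p i * F i) ≤ a * I := fun i => by
      calc _ ≤ H * (H * ((k + 1) * nP k (P i))) :=
            mul_le_mul_of_nonneg_left (mul_le_mul (hlen' i) (hF' i) (F0 i) hH0.le) hH0.le
        _ = (k + 1) * (H ^ 2 * nP k (P i)) := by ring
        _ ≤ _ := xP i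
    have xE : ∀ i, H ^ 3 * (elen p i * E i) ≤ (k + 1) * b * I := fun i => by
      calc _ ≤ H ^ 3 * (H * ((k + 1) * nP k (R i))) :=
            mul_le_mul_of_nonneg_left (mul_le_mul (hlen' i) (hE' i) (E0 i) hH0.le) (by positivity)
        _ = (k + 1) * (H ^ 4 * nP k (R i)) := by ring
        _ ≤ (k + 1) * (b * I) := mul_le_mul_of_nonneg_left (xR i) (by positivity)
        _ = _ := by ring
    have xv : ∀ i, H ^ 2 * (f (i + 1) 1) ^ 2 ≤ a * I := fun i => by
      calc _ ≤ H ^ 2 * ((k + 1) * nP k (P (i + 1))) :=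
            mul_le_mul_of_nonneg_left (hv' i) (by positivity)
        _ = (k + 1) * (H ^ 2 * nP k (P (i + 1))) := by ring
        _ ≤ _ := xP _
    have xw : ∀ i, H ^ 4 * ‖w i‖ ^ 2 ≤ (μ ^ 2 * k ^ 2 * a + (k + 1) * b) * I := fun i => by
      obtain ⟨l, hl⟩ : ∃ l, l = elen p (i + 1) := ⟨_, rfl⟩
      have g1 := hW' i
      have g2 := hHl (i + 1)
      have g3 := hl0 (i + 1)
      rw [← hl] at g1 g2 g3
      have n1 := nPn (P (i + 1))
      have n2 := nPn (R (i + 1))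
      have g4 : l ^ 2 * (H ^ 4 * ‖w i‖ ^ 2) ≤
          l ^ 2 * ((μ ^ 2 * k ^ 2 * a + (k + 1) * b) * I) := by
        calc _ = H ^ 4 * (l ^ 2 * ‖w i‖ ^ 2) := by ring
          _ ≤ H ^ 4 * _ := mul_le_mul_of_nonneg_left g1 (by positivity)
          _ = H ^ 2 * (k ^ 2 * ((k + 1) * (H ^ 2 * nP k (P (i + 1)))))
              + l ^ 2 * ((k + 1) * (H ^ 4 * nP k (R (i + 1)))) := by ring
          _ ≤ (μ * l) ^ 2 * (k ^ 2 * (a * I)) + l ^ 2 * ((k + 1) * (b * I)) := by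
              refine add_le_add (mul_le_mul (pow_le_pow_left₀ hH0.le g2 2)
                (mul_le_mul_of_nonneg_left (xP _) (by positivity)) (by positivity) (by positivity))
                (mul_le_mul_of_nonneg_left (mul_le_mul_of_nonneg_left (xR _) (by positivity))
                  (by positivity))
          _ = _ := by ring
      exact le_of_mul_le_mul_left g4 (by positivity)
    have w1 : Y1 ≤ 3 * (a + (k + 1) * b) * I := by
      rw [hY1]
      calc _ ≤ ∑ i : Fin 3, (a * I + (k + 1) * b * I) :=
            Finset.sum_le_sum fun i _ => add_le_add (xF i) (xE i)
        _ = _ := by simp; ring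
    have w2 : Y2 ≤ 3 * (a + (μ ^ 2 * k ^ 2 * a + (k + 1) * b)) * I := by
      rw [hY2]
      calc _ ≤ ∑ i : Fin 3, (a * I + (μ ^ 2 * k ^ 2 * a + (k + 1) * b) * I) :=
            Finset.sum_le_sum fun i _ => add_le_add (xv i) (xw i)
        _ = _ := by simp; ring
    rw [hY]
    linarith
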